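/- arXiv:1910.12158 — 2 statements merged into one kernel-verified Lean document; each statement's English description precedes it below -/
import Mathlib

section
/- If two admissible Wilson loop diagrams differ by a dihedral transformation, then their Le diagrams contain the same number of + entries. -/
open scoped Classical

namespace WLD

/-- A propagator of a Wilson loop diagram on the cyclically ordered vertex set
`ZMod n` (vertex `n` is identified with `0`): an unordered pair of edges, the
edge joining vertex `i` to vertex `i+1` being labelled `i`. -/
abbrev Prp (n : ℕ) := Sym2 (ZMod n)

variable (n : ℕ)

/-- The position of `x` in the linear order `i <_i i+1 <_i ⋯ <_i i-1`. -/
def ord (i x : ZMod n) : ℕ := (x - i).val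

/-- The other end of a propagator `p` having an end on the edge `e`. -/
noncomputable def otherEnd (p : Prp n) (e : ZMod n) : ZMod n :=
  if h : e ∈ p then Sym2.Mem.other h else e

/-- The vertex support `V(p) = {i, i+1, j, j+1}` of the propagator `p = (i,j)`. -/
def supp (p : Prp n) : Finset (ZMod n) :=
  Sym2.lift ⟨fun i j => {i, i + 1, j, j + 1}, fun i j => by
    ext x
    simp only [Finset.mem_insert, Finset.mem_singleton]
    tauto⟩ p

/-- The vertex support `V(Q)` of a set of propagators. -/
def suppSet (Q : Finset (Prp n)) : Finset (ZMod n) := Q.biUnion (supp n)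

/-- `Prop(U)`: the propagators of `P` supported on (a vertex of) `U`. -/
noncomputable def propsOn (P : Finset (Prp n)) (U : Finset (ZMod n)) : Finset (Prp n) :=
  P.filter fun p => (supp n p ∩ U).Nonempty

/-- Two propagators `p = (i,j)` and `q = (k,l)` cross if `i < k < j < l` cyclically. -/
def Crossing (p q : Prp n) : Prop :=
  ∃ i j k l : ZMod n, p = s(i, j) ∧ q = s(k, l) ∧
    0 < ord n i k ∧ ord n i k < ord n i j ∧ ord n i j < ord n i l

/-- Weak admissibility of a Wilson loop diagram. -/
structure IsWeaklyAdmissible (P : Finset (Prp n)) : Prop where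
  dense : ∀ Q ⊆ P, Q.Nonempty → Q.card + 3 ≤ (suppSet n Q).card
  noncross : ∀ p ∈ P, ∀ q ∈ P, ¬ Crossing n p q

/-- Admissibility of a Wilson loop diagram. -/
structure IsAdmissible (P : Finset (Prp n)) : Prop where
  card_add_four_le : P.card + 4 ≤ n
  dense : ∀ Q ⊆ P, Q.Nonempty → Q.card + 3 ≤ (suppSet n Q).card
  noncross : ∀ p ∈ P, ∀ q ∈ P, ¬ Crossing n p q

/-- The length of a propagator `p = (i,j)`:
`min(|[i+1, j]|, |[j+1, i]|)`, the number of vertices on its smaller side. -/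
def plength (p : Prp n) : ℕ :=
  Sym2.lift ⟨fun i j => min ((j - i - 1).val + 1) ((i - j - 1).val + 1),
    fun _ _ => min_comm _ _⟩ p

/-- `InsideDir n i p q` : the propagator `q = (k,l)` lies (weakly) inside the
propagator `p = (i,j)` directed from its end `i`, i.e. `i ≤_i k <_i l ≤_i j`. -/
def InsideDir (i : ZMod n) (p q : Prp n) : Prop :=
  ∃ j k l : ZMod n, p = s(i, j) ∧ q = s(k, l) ∧
    ord n i k < ord n i l ∧ ord n i l ≤ ord n i j

/-- Sorting key measuring how far clockwise of the vertex `a` the relevant end of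
a propagator supported on `a` is attached: ends on the edge `a-1` are clockwise of
ends on the edge `a`, and on a fixed edge an end is the more clockwise the larger
the propagator is (nestedness of noncrossing propagators sharing an edge). -/
noncomputable def cwKey (a : ZMod n) (p : Prp n) : ℕ :=
  if a - 1 ∈ p then n + ord n (a - 1) (otherEnd n p (a - 1))
  else ord n a (otherEnd n p a)

/-- The clockwise-most propagator of `S` supported on the vertex `a`, if any. -/
noncomputable def pickCW (S : Finset (Prp n)) (a : ZMod n) : Option (Prp n) :=
  if h : (S.filter fun p => a ∈ supp n p).Nonempty then
    some (Classical.choose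
      ((S.filter fun p => a ∈ supp n p).exists_max_image (cwKey n a) h))
  else none

/-- The Grassmann necklace algorithm started at the vertex `i`: after `t` steps,
`(gnRun n P i t).1` is the set of propagators not yet deleted, and
`(gnRun n P i t).2` records the vertex assigned to each deleted propagator.
Step `t+1` processes the vertex `i + t`: if some not-yet-deleted propagator is
supported on it, the clockwise-most such propagator is deleted and assigned
that vertex. -/
noncomputable def gnRun (P : Finset (Prp n)) (i : ZMod n) :
    ℕ → Finset (Prp n) × (Prp n → Option (ZMod n))
  | 0 => (P, fun _ => none)
  | t + 1 =>
    match pickCW n (gnRun P i t).1 (i + (t : ZMod n)) with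
    | none => gnRun P i t
    | some p => ((gnRun P i t).1.erase p,
        Function.update (gnRun P i t).2 p (some (i + (t : ZMod n))))

/-- `I_i^W(p)`: the vertex contributed by the propagator `p` to the Grassmann
necklace term `I_i^W` (as an `Option`; the algorithm makes one full circuit of
the vertex set, i.e. runs for `n` steps). -/
noncomputable def gnAssign (P : Finset (Prp n)) (i : ZMod n) (p : Prp n) :
    Option (ZMod n) :=
  (gnRun n P i n).2 p

/-- The Grassmann necklace term `I_i^W` produced by the algorithm. -/
noncomputable def gnSet [NeZero n] (P : Finset (Prp n)) (i : ZMod n) :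
    Finset (ZMod n) :=
  Finset.univ.filter fun v => ∃ p, gnAssign n P i p = some v

/-- The cyclic interval `{a, a+1, …, a + (len-1)}` in `ZMod n`. -/
def cInterval [NeZero n] (a : ZMod n) (len : ℕ) : Finset (ZMod n) :=
  Finset.univ.filter fun x => ord n a x < len

/-- A Grassmann necklace of type `(k, n)`: a cyclic sequence of `k`-element
subsets of the vertex set such that `I_{i+1} = (I_i \ {i}) ∪ {j}` for some `j`
whenever `i ∈ I_i`, and `I_{i+1} = I_i` otherwise. -/
def IsGrassmannNecklace [NeZero n] (k : ℕ) (I : ZMod n → Finset (ZMod n)) : Prop :=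
  (∀ i, (I i).card = k) ∧
  ∀ i : ZMod n,
    (i ∈ I i → ∃ j : ZMod n, I (i + 1) = insert j ((I i).erase i)) ∧
    (i ∉ I i → I (i + 1) = I i)

/-- Independence in the matroid `M(W)`: no subset `U` of `J` supports fewer
propagators than the vertices it contains. -/
def Indep (P : Finset (Prp n)) (J : Finset (ZMod n)) : Prop :=
  ∀ U ⊆ J, U.card ≤ (propsOn n P U).card

/-- `A` is lexicographically smaller than `B` with respect to the order `<_i`:
the `<_i`-least element of the symmetric difference lies in `A`. -/
def LexLt (i : ZMod n) (A B : Finset (ZMod n)) : Prop :=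
  ∃ v, v ∈ A ∧ v ∉ B ∧ ∀ w, ord n i w < ord n i v → (w ∈ A ↔ w ∈ B)

/-- A `+` is placed in the box `(a, b)` of the Le diagram with row labels `I₁`
by the necklace term `Ii`: writing `I₁ \ Ii = {a₁ > ⋯ > a_r}` and
`Ii \ I₁ = {b₁ < ⋯ < b_r}` in the `<₁` order, the plusses are in the boxes
`(a_t, b_t)`. -/
def LePlusAt (I₁ Ii : Finset (ZMod n)) (a b : ZMod n) : Prop :=
  a ∈ I₁ \ Ii ∧ b ∈ Ii \ I₁ ∧
    ((I₁ \ Ii).filter fun x => ord n 1 a < ord n 1 x).card =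
      ((Ii \ I₁).filter fun y => ord n 1 y < ord n 1 b).card

/-- The box `(a, b)` of the Le diagram of the diagram `P` contains a `+`. -/
def LePlus [NeZero n] (P : Finset (Prp n)) (a b : ZMod n) : Prop :=
  ∃ i : ZMod n, LePlusAt n (gnSet n P 1) (gnSet n P i) a b

/-- The number of `+` entries in the Le diagram of the diagram `P`. -/
noncomputable def plusCount [NeZero n] (P : Finset (Prp n)) : ℕ :=
  (Finset.univ.filter fun ab : ZMod n × ZMod n => LePlus n P ab.1 ab.2).card

/-- The length of the row labelled `a` of the Young diagram with row labels `I₁`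
(the boxes of row `a` are indexed by the column labels `b ∉ I₁` with `a <₁ b`). -/
noncomputable def rowLen [NeZero n] (I₁ : Finset (ZMod n)) (a : ZMod n) : ℕ :=
  (Finset.univ.filter fun b => b ∉ I₁ ∧ ord n 1 a < ord n 1 b).card

/-- The entry of the matrix `C(W)` in row `p` and column `q`: the indeterminate
`x_{p,q}` if `q ∈ V(p)`, and `0` otherwise. -/
noncomputable def CW (p : Prp n) (q : ZMod n) : MvPolynomial (Prp n × ZMod n) ℝ :=
  if q ∈ supp n p then MvPolynomial.X (p, q) else 0

/-- The column paired with the row `p` in the minors determined by `I_i^W`. -/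
noncomputable def colOf (P : Finset (Prp n)) (i : ZMod n) (p : Prp n) : ZMod n :=
  (gnAssign n P i p).getD i

/-- `Δ_{I_i}`: the determinant of the `k × k` minor of `C(W)` on the columns
indexed by `I_i^W`, rows and columns paired via the necklace assignment. -/
noncomputable def Delta (P : Finset (Prp n)) (i : ZMod n) :
    MvPolynomial (Prp n × ZMod n) ℝ :=
  Matrix.det (Matrix.of fun p q : ↥P => CW n (p : Prp n) (colOf n P i (q : Prp n)))

/-- `S_i`: the propagators whose contribution changes from `I_{i-1}` to `I_i`. -/
noncomputable def Schanged (P : Finset (Prp n)) (i : ZMod n) : Finset (Prp n) :=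
  P.filter fun p => gnAssign n P (i - 1) p ≠ gnAssign n P i p

/-- `r_i`: the determinant of the minor of `C(W)` with rows indexed by `S_i` and
columns indexed by `I_i(S_i)` (equal to `1` when `S_i = ∅`). -/
noncomputable def rfac (P : Finset (Prp n)) (i : ZMod n) :
    MvPolynomial (Prp n × ZMod n) ℝ :=
  Matrix.det
    (Matrix.of fun p q : ↥(Schanged n P i) => CW n (p : Prp n) (colOf n P i (q : Prp n)))

/-- `R = ∏ᵢ rᵢ`, the polynomial produced by the algorithm. -/
noncomputable def Rpoly [NeZero n] (P : Finset (Prp n)) :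
    MvPolynomial (Prp n × ZMod n) ℝ :=
  ∏ i : ZMod n, rfac n P i

/-- Position of the end of the propagator `p` along the edge `e`: larger values
attach closer to the vertex `e`, i.e. earlier in the counterclockwise ordering
of the ends of propagators along the edge `e`. -/
noncomputable def edgeKey (e : ZMod n) (p : Prp n) : ℕ := ord n e (otherEnd n p e)

/-- The propagators of `P` with an end on the edge `e`. -/
noncomputable def onEdge (P : Finset (Prp n)) (e : ZMod n) : Finset (Prp n) :=
  P.filter fun p => e ∈ p

/-- `p` is the first propagator (`p₁`) on the edge `e` in the counterclockwise
ordering of the propagators with an end on the edge `e`. -/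
def IsCcwFirst (P : Finset (Prp n)) (e : ZMod n) (p : Prp n) : Prop :=
  p ∈ onEdge n P e ∧ ∀ q ∈ onEdge n P e, edgeKey n e q ≤ edgeKey n e p

/-- `p` is the last propagator (`p_r`) on the edge `e` in the counterclockwise
ordering of the propagators with an end on the edge `e`. -/
def IsCcwLast (P : Finset (Prp n)) (e : ZMod n) (p : Prp n) : Prop :=
  p ∈ onEdge n P e ∧ ∀ q ∈ onEdge n P e, edgeKey n e p ≤ edgeKey n e q

/-- `p` and `q` are consecutive, in this order (`p = p_j`, `q = p_{j+1}`), in the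
counterclockwise ordering of the propagators with an end on the edge `e`. -/
def ConsecOnEdge (P : Finset (Prp n)) (e : ZMod n) (p q : Prp n) : Prop :=
  p ∈ onEdge n P e ∧ q ∈ onEdge n P e ∧ edgeKey n e q < edgeKey n e p ∧
    ∀ r ∈ onEdge n P e, ¬ (edgeKey n e q < edgeKey n e r ∧ edgeKey n e r < edgeKey n e p)

/-- The factor `R_e` of the denominator `R(W)` associated to the edge `e`:
`R_e = x_{p₁,e+1} • ∏_{j=1}^{r-1} (x_{p_j,e} x_{p_{j+1},e+1} - x_{p_{j+1},e} x_{p_j,e+1}) • x_{p_r,e}`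
for the counterclockwise ordering `p₁, …, p_r` of the propagators on the edge `e`
(`R_e = 1` if there are none). -/
noncomputable def Redge (P : Finset (Prp n)) (e : ZMod n) :
    MvPolynomial (Prp n × ZMod n) ℝ :=
  (∏ p ∈ (onEdge n P e).filter (IsCcwFirst n P e), MvPolynomial.X (p, e + 1)) *
    (∏ pq ∈ (P ×ˢ P).filter (fun pq => ConsecOnEdge n P e pq.1 pq.2),
      (MvPolynomial.X (pq.1, e) * MvPolynomial.X (pq.2, e + 1) -
        MvPolynomial.X (pq.2, e) * MvPolynomial.X (pq.1, e + 1))) *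
    (∏ p ∈ (onEdge n P e).filter (IsCcwLast n P e), MvPolynomial.X (p, e))

/-- The denominator `R(W) = ∏ₑ R_e` of the integrand `Ω(W)`. -/
noncomputable def RW [NeZero n] (P : Finset (Prp n)) :
    MvPolynomial (Prp n × ZMod n) ℝ :=
  ∏ e : ZMod n, Redge n P e

/-- The relabelling map associated to the removal of the vertex `i` from the
vertex set `ZMod n`: the vertex of `ZMod (n-1)` in position `t` (in the `<₁`
order) is sent to the vertex of `ZMod n` in position `t` if `t` precedes the
position of `i`, and to the vertex in position `t+1` otherwise. -/
noncomputable def liftVert (i : ZMod n) (x : ZMod (n - 1)) : ZMod n :=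
  1 + ((if ord (n - 1) 1 x < ord n 1 i then ord (n - 1) 1 x
        else ord (n - 1) 1 x + 1 : ℕ) : ZMod n)

end WLD
namespace WLD

/-- The greedy sweep of the Grassmann necklace algorithm in linear coordinates. Vertices are
`0, …, n - 1` in order of visit, edge `s` joins the vertices `s - 1` and `s` (edge `0` also
touches `n - 1`), and a propagator joins its edges `lo < hi`. -/
structure Sweep (α : Type*) (n : ℕ) where
  P : Finset α
  lo : α → ℕ
  hi : α → ℕ
  R : ℕ → Finset α
  pk : ℕ → Option α

namespace Sweep

variable {α : Type*} {n : ℕ} (S : Sweep α n)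

/-- The propagator `p` is supported on the vertex `u`. -/
def Sup (p : α) (u : ℕ) : Prop :=
  u + 1 = S.lo p ∨ u = S.lo p ∨ u + 1 = S.hi p ∨ u = S.hi p ∨ (S.lo p = 0 ∧ u + 1 = n)

/-- How far clockwise `p` is attached at the vertex `u`. -/
noncomputable def key (u : ℕ) (p : α) : ℕ :=
  if u = S.lo p then n + (S.hi p - S.lo p)
  else if u = S.hi p then n + (S.lo p + n - S.hi p)
  else if u + 1 = S.hi p then S.lo p + n - S.hi p
  else S.hi p - S.lo p

/-- The sweep processes a noncrossing family by the clockwise-most rule. -/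
structure Valid : Prop where
  gap : ∀ p ∈ S.P, S.lo p + 2 ≤ S.hi p
  hi_lt : ∀ p ∈ S.P, S.hi p < n
  inj : ∀ p ∈ S.P, ∀ q ∈ S.P, S.lo p = S.lo q → S.hi p = S.hi q → p = q
  noncross : ∀ p ∈ S.P, ∀ q ∈ S.P, ¬ (S.lo p < S.lo q ∧ S.lo q < S.hi p ∧ S.hi p < S.hi q)
  zero : S.R 0 = S.P
  none_succ : ∀ u, S.pk u = none → S.R (u + 1) = S.R u
  none_sup : ∀ u < n, S.pk u = none → ∀ p ∈ S.R u, ¬ S.Sup p u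
  some_mem : ∀ u p, S.pk u = some p → p ∈ S.R u
  some_sup : ∀ u < n, ∀ p, S.pk u = some p → S.Sup p u
  some_succ : ∀ u p, S.pk u = some p → S.R (u + 1) = (S.R u).erase p
  some_max : ∀ u < n, ∀ p, S.pk u = some p → ∀ q ∈ S.R u, S.Sup q u → S.key u q ≤ S.key u p

namespace Valid

variable {S} (h : S.Valid)
include h

theorem R_succ_subset (u : ℕ) : S.R (u + 1) ⊆ S.R u := by
  cases hp : S.pk u with
  | none => rw [h.none_succ u hp]
  | some p => rw [h.some_succ u p hp]; exact Finset.erase_subset _ _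

theorem R_anti {u v : ℕ} (huv : u ≤ v) : S.R v ⊆ S.R u :=
  antitone_nat_of_succ_le (f := S.R) h.R_succ_subset huv

theorem R_subset (u : ℕ) : S.R u ⊆ S.P := h.zero ▸ h.R_anti (Nat.zero_le u)

theorem not_mem_of_pk {u v : ℕ} {p : α} (hp : S.pk u = some p) (huv : u < v) : p ∉ S.R v := by
  intro hv
  have := h.R_anti (Nat.succ_le_of_lt huv) hv
  rw [Nat.succ_eq_add_one, h.some_succ u p hp] at this
  simp at this

theorem exists_pk {v : ℕ} {p : α} (hp : p ∈ S.P) (hv : p ∉ S.R v) : ∃ u < v, S.pk u = some p := by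
  induction v with
  | zero => rw [h.zero] at hv; exact absurd hp hv
  | succ v ih =>
    by_cases hpv : p ∈ S.R v
    · cases hq : S.pk v with
      | none => rw [h.none_succ v hq] at hv; exact absurd hpv hv
      | some q =>
        rw [h.some_succ v q hq] at hv
        have : p = q := by
          by_contra hne
          exact hv (Finset.mem_erase.2 ⟨hne, hpv⟩)
        exact ⟨v, Nat.lt_succ_self v, this ▸ hq⟩
    · obtain ⟨u, hu, hp⟩ := ih hpv
      exact ⟨u, hu.trans (Nat.lt_succ_self v), hp⟩

theorem pk_inj {u v : ℕ} {p : α} (hu : S.pk u = some p) (hv : S.pk v = some p) : u = v := by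
  rcases lt_trichotomy u v with hlt | heq | hlt
  · exact absurd (h.some_mem v p hv) (h.not_mem_of_pk hu hlt)
  · exact heq
  · exact absurd (h.some_mem u p hu) (h.not_mem_of_pk hv hlt)

theorem exists_better {u : ℕ} (hu : u < n) {p : α} (hp : p ∈ S.R u) (hs : S.Sup p u) :
    ∃ q, S.pk u = some q ∧ S.key u p ≤ S.key u q := by
  cases hq : S.pk u with
  | none => exact absurd hs (h.none_sup u hu hq p hp)
  | some q => exact ⟨q, rfl, h.some_max u hu q hq p hp hs⟩

/-- At a vertex of the first edge of `p`, a propagator nested in `p` is not preferred to `p`. -/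
theorem eq_of_key_le {u : ℕ} (hu : u < n) {p q : α} (hp : p ∈ S.P) (hq : q ∈ S.P)
    (hlo : S.lo p ≤ S.lo q) (hhi : S.hi q ≤ S.hi p) (hup : u + 1 = S.lo p ∨ u = S.lo p)
    (hs : S.Sup q u) (hk : S.key u p ≤ S.key u q) : p = q := by
  have := h.gap p hp
  have := h.gap q hq
  have := h.hi_lt p hp
  have := h.hi_lt q hq
  unfold Sup at hs
  unfold key at hk
  apply h.inj p hp q hq <;> split_ifs at hk <;> omega

/-- No propagator joins an edge strictly between `a` and `b` to one outside `[a, b]`. -/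
def _root_.WLD.Sweep.Closed (S : Sweep α n) (a b : ℕ) : Prop :=
  ∀ p ∈ S.P, (a < S.lo p ∧ S.lo p < b) ∨ (a < S.hi p ∧ S.hi p < b) → a ≤ S.lo p ∧ S.hi p ≤ b

/-- If only the chord `(a, b)` can survive inside a closed interval until `b - 1`, nothing
inside survives the vertex `b - 1`. -/
theorem not_mem_of_closed {a b : ℕ} (hb : b < n) (hab : a + 2 ≤ b) (hc : S.Closed a b)
    (hs : ∀ p ∈ S.R (b - 1), a ≤ S.lo p → S.hi p ≤ b → S.lo p = a ∧ S.hi p = b)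
    {p : α} (hp : p ∈ S.R b) (hlo : a ≤ S.lo p) (hhi : S.hi p ≤ b) : False := by
  have hp' := h.R_anti (Nat.sub_le b 1) hp
  obtain ⟨h1, h2⟩ := hs p hp' hlo hhi
  have hpP := h.R_subset _ hp
  obtain ⟨q, hq, hk⟩ := h.exists_better (u := b - 1) (by omega) hp' (by unfold Sup; omega)
  have hqR := h.some_mem _ _ hq
  have hqP := h.R_subset _ hqR
  have hqs := h.some_sup _ (by omega) _ hq
  have := h.gap q hqP
  have := h.hi_lt q hqP
  have hcq := hc q hqP
  have hJ : a ≤ S.lo q ∧ S.hi q ≤ b := by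
    unfold Sup at hqs
    unfold key at hk
    split_ifs at hk <;> omega
  obtain ⟨h3, h4⟩ := hs q hqR hJ.1 hJ.2
  have : p = q := h.inj p hpP q hqP (by omega) (by omega)
  subst this
  exact h.not_mem_of_pk hq (by omega) hp

theorem closed_survivor (a b : ℕ) (hb : b < n) (hc : S.Closed a b) (p : α)
    (hp : p ∈ S.R (b - 1)) (hlo : a ≤ S.lo p) (hhi : S.hi p ≤ b) :
    (S.lo p = a ∧ S.hi p = b) ∧
      ∃ q, S.pk a = some q ∧ ¬ (a ≤ S.lo q ∧ S.hi q ≤ b) := by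
  induction hd : b - a using Nat.strong_induction_on generalizing a b p with
  | _ d ih =>
  have hpP := h.R_subset _ hp
  have hgap := h.gap p hpP
  have ih' : ∀ a' b', b' < n → b' - a' < b - a → S.Closed a' b' → ∀ p ∈ S.R (b' - 1),
      a' ≤ S.lo p → S.hi p ≤ b' → (S.lo p = a' ∧ S.hi p = b') ∧
      ∃ q, S.pk a' = some q ∧ ¬ (a' ≤ S.lo q ∧ S.hi q ≤ b') :=
    fun a' b' hb' hlt hc' p hp h1 h2 => ih (b' - a') (hd ▸ hlt) a' b' hb' hc' p hp h1 h2 rfl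
  by_cases heq : S.lo p = a ∧ S.hi p = b
  · refine ⟨heq, ?_⟩
    have hpa : p ∈ S.R a := h.R_anti (by omega) hp
    obtain ⟨q, hq, hk⟩ := h.exists_better (u := a) (by omega) hpa (by unfold Sup; omega)
    refine ⟨q, hq, fun hJ => ?_⟩
    have hqP := h.R_subset _ (h.some_mem _ _ hq)
    have : p = q := h.eq_of_key_le (u := a) (by omega) hpP hqP (by omega) (by omega)
      (by omega) (h.some_sup _ (by omega) _ hq) hk
    subst this
    exact h.not_mem_of_pk hq (by omega) hp
  exfalso
  by_cases hex : ∃ q ∈ S.P, S.lo q = a ∧ S.hi q < b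
  · obtain ⟨q, hq, hmax⟩ := (S.P.filter fun q => S.lo q = a ∧ S.hi q < b).exists_max_image S.hi
      (by obtain ⟨q, hq, hq'⟩ := hex; exact ⟨q, Finset.mem_filter.2 ⟨hq, hq'⟩⟩)
    obtain ⟨hqP, hqa, hqb⟩ := Finset.mem_filter.1 hq
    have hmax' : ∀ r ∈ S.P, S.lo r = a → S.hi r < b → S.hi r ≤ S.hi q :=
      fun r hr h1 h2 => hmax r (Finset.mem_filter.2 ⟨hr, h1, h2⟩)
    have hqgap := h.gap q hqP
    have hc1 : S.Closed a (S.hi q) := by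
      intro r hr hr'
      have := hc r hr
      have := h.noncross q hqP r hr
      have := h.gap r hr
      omega
    have hc2 : S.Closed (S.hi q) b := by
      intro r hr hr'
      have := hc r hr
      have := h.noncross q hqP r hr
      have := h.gap r hr
      have := hmax' r hr
      omega
    have hdone : ∀ r ∈ S.R (S.hi q), a ≤ S.lo r → S.hi r ≤ S.hi q → False := by
      intro r hr h1 h2
      exact h.not_mem_of_closed (a := a) (by omega) (by omega) hc1
        (fun p hp h1 h2 => (ih' a (S.hi q) (by omega) (by omega) hc1 p hp h1 h2).1) hr h1 h2
    by_cases hpo : S.hi p ≤ S.hi q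
    · exact hdone p (h.R_anti (by omega) hp) hlo hpo
    · have hlo' : S.hi q ≤ S.lo p := by
        have := h.noncross q hqP p hpP
        have := hmax' p hpP
        omega
      obtain ⟨hpe, x, hx, hxJ⟩ := ih' (S.hi q) b hb (by omega) hc2 p hp hlo' hhi
      have hxR := h.some_mem _ _ hx
      have hxP := h.R_subset _ hxR
      have hxs := h.some_sup _ (by omega) _ hx
      have h1 := hc x hxP
      have h2 := hc2 x hxP
      have h3 := h.gap x hxP
      have h4 : ¬ (a ≤ S.lo x ∧ S.hi x ≤ S.hi q) := fun hx => hdone x hxR hx.1 hx.2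
      unfold Sup at hxs
      omega
  · push Not at hex
    have hc1 : S.Closed (a + 1) b := by
      intro r hr hr'
      have := hc r hr
      have := hex r hr
      have := h.gap r hr
      omega
    have := hex p hpP
    obtain ⟨hpe, x, hx, hxJ⟩ := ih' (a + 1) b hb (by omega) hc1 p hp (by omega) hhi
    have hxP := h.R_subset _ (h.some_mem _ _ hx)
    have hxs := h.some_sup _ (by omega) _ hx
    have h1 := hc x hxP
    have h3 := h.gap x hxP
    have h4 := hex x hxP
    unfold Sup at hxs
    omega

/-- Every propagator is deleted before the vertex `hi p` is visited. -/
theorem not_mem_R_hi {p : α} (hp : p ∈ S.P) : p ∉ S.R (S.hi p) := by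
  intro hR
  have hc : S.Closed (S.lo p) (S.hi p) := by
    intro r hr hr'
    have := h.noncross p hp r hr
    have := h.noncross r hr p hp
    have := h.gap r hr
    omega
  exact h.not_mem_of_closed (h.hi_lt p hp) (h.gap p hp) hc
    (fun r hr h1 h2 => (h.closed_survivor _ _ (h.hi_lt p hp) hc r hr h1 h2).1) hR le_rfl le_rfl

omit h in
/-- Vertices reachable from `v` along alternating paths of the assignment. -/
inductive _root_.WLD.Sweep.Reach (S : Sweep α n) (v : ℕ) : ℕ → Prop
  | base : S.Reach v v
  | step {x u : ℕ} {p : α} : S.Reach v x → S.Sup p x → S.pk u = some p → S.Reach v u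

theorem reach_inside {v : ℕ} (hv : v < n) (hnone : S.pk v = none) {x : ℕ} (hx : S.Reach v x) :
    x ≤ v ∧ ∀ p ∈ S.R v, ¬ S.Sup p x ∧ (S.lo p ≤ v → S.lo p < x ∧ x + 1 < S.hi p) := by
  have hbase : ∀ p ∈ S.R v, S.lo p ≤ v → S.lo p < v ∧ v + 1 < S.hi p := by
    intro p hp hlo
    have hs := h.none_sup v hv hnone p hp
    have hpP := h.R_subset _ hp
    have : v < S.hi p := by
      by_contra hge
      exact h.not_mem_R_hi hpP (h.R_anti (by omega) hp)
    unfold Sup at hs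
    omega
  induction hx with
  | base => exact ⟨le_rfl, fun p hp => ⟨h.none_sup v hv hnone p hp, hbase p hp⟩⟩
  | @step x u p' hx hs hu ih =>
    obtain ⟨hxv, ih⟩ := ih
    have hp'R : p' ∉ S.R v := fun hp' => (ih p' hp').1 hs
    have huv : u < v := by
      by_contra hge
      exact hp'R (h.R_anti (by omega) (h.some_mem _ _ hu))
    have hp'P := h.R_subset _ (h.some_mem _ _ hu)
    refine ⟨huv.le, fun p hp => ?_⟩
    have hpP := h.R_subset _ hp
    have hin : S.lo p ≤ v → S.lo p < u ∧ u + 1 < S.hi p := by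
      intro hlo
      obtain ⟨h1, h2⟩ := (ih p hp).2 hlo
      obtain ⟨h3, h4⟩ := hbase p hp hlo
      have hn1 := h.noncross p hpP p' hp'P
      have hn2 := h.noncross p' hp'P p hpP
      have hg := h.gap p' hp'P
      have hh := h.hi_lt p hpP
      have hnest : S.lo p ≤ S.lo p' ∧ S.hi p' ≤ S.hi p := by
        unfold Sup at hs
        omega
      have hsu := h.some_sup u (by omega) p' hu
      have hlt : S.lo p < u := by
        by_contra hge
        have hup : u + 1 = S.lo p ∨ u = S.lo p := by
          unfold Sup at hsu
          omega
        have hk := h.some_max u (by omega) p' hu p (h.R_anti huv.le hp)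
          (by unfold Sup; omega)
        have := h.eq_of_key_le (u := u) (by omega) hpP hp'P hnest.1 hnest.2 hup hsu hk
        exact hp'R (this ▸ hp)
      exact ⟨hlt, by omega⟩
    refine ⟨?_, hin⟩
    have := h.none_sup v hv hnone p hp
    have := h.hi_lt p hpP
    have := h.gap p hpP
    unfold Sup at *
    omega

/-- A tight set certifying that the greedy assignment is maximal on the first `T` vertices. -/
theorem exists_tight (T : ℕ) (hT : T ≤ n) :
    ∃ X ⊆ Finset.range T, (∀ u < T, S.pk u = none → u ∈ X) ∧
      ∀ x ∈ X, ∀ p ∈ S.P, S.Sup p x → ∃ u ∈ X, S.pk u = some p := by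
  refine ⟨(Finset.range T).filter fun x => ∃ v < T, S.pk v = none ∧ S.Reach v x,
    Finset.filter_subset _ _, fun u hu hnone => ?_, fun x hx p hp hs => ?_⟩
  · exact Finset.mem_filter.2 ⟨Finset.mem_range.2 hu, u, hu, hnone, Reach.base⟩
  · obtain ⟨-, v, hv, hnone, hr⟩ := Finset.mem_filter.1 hx
    have hpv : p ∉ S.R v := fun hpv =>
      ((h.reach_inside (by omega) hnone hr).2 p hpv).1 hs
    obtain ⟨u, hu, hpk⟩ := h.exists_pk hp hpv
    exact ⟨u, Finset.mem_filter.2 ⟨Finset.mem_range.2 (by omega), v, hv, hnone,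
      hr.step hs hpk⟩, hpk⟩

end Valid
end Sweep

section Rank

variable {n : ℕ}

/-- The rank of a vertex set in the transversal matroid of the support relation. -/
noncomputable def vrank (P : Finset (Prp n)) (S : Finset (ZMod n)) : ℕ :=
  S.powerset.inf' ⟨∅, Finset.empty_mem_powerset S⟩
    fun U => (propsOn n P U).card + (S \ U).card

theorem vrank_le {P : Finset (Prp n)} {S U : Finset (ZMod n)} (hU : U ⊆ S) :
    vrank P S ≤ (propsOn n P U).card + (S \ U).card :=
  Finset.inf'_le _ (Finset.mem_powerset.2 hU)

theorem exists_vrank_eq (P : Finset (Prp n)) (S : Finset (ZMod n)) :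
    ∃ U ⊆ S, vrank P S = (propsOn n P U).card + (S \ U).card := by
  obtain ⟨U, hU, h⟩ := Finset.exists_mem_eq_inf' (s := S.powerset)
    ⟨∅, Finset.empty_mem_powerset S⟩ fun U => (propsOn n P U).card + (S \ U).card
  exact ⟨U, Finset.mem_powerset.1 hU, h⟩

theorem mem_propsOn {P : Finset (Prp n)} {U : Finset (ZMod n)} {p : Prp n} :
    p ∈ propsOn n P U ↔ p ∈ P ∧ ∃ x ∈ U, x ∈ supp n p := by
  simp only [propsOn, Finset.mem_filter, Finset.Nonempty, Finset.mem_inter]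
  exact and_congr_right fun _ => exists_congr fun _ => and_comm

theorem propsOn_mono {P : Finset (Prp n)} {U V : Finset (ZMod n)} (h : U ⊆ V) :
    propsOn n P U ⊆ propsOn n P V := fun p hp => by
  obtain ⟨hp, x, hx, hxp⟩ := mem_propsOn.1 hp
  exact mem_propsOn.2 ⟨hp, x, h hx, hxp⟩

theorem vrank_submodular (P : Finset (Prp n)) (A B : Finset (ZMod n)) :
    vrank P (A ∪ B) + vrank P (A ∩ B) ≤ vrank P A + vrank P B := by
  obtain ⟨U, hU, hUe⟩ := exists_vrank_eq P A
  obtain ⟨V, hV, hVe⟩ := exists_vrank_eq P B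
  have h1 := vrank_le (P := P) (Finset.union_subset_union hU hV)
  have h2 := vrank_le (P := P) (Finset.inter_subset_inter hU hV)
  have e1 := Finset.card_sdiff_add_card_eq_card hU
  have e2 := Finset.card_sdiff_add_card_eq_card hV
  have e3 := Finset.card_sdiff_add_card_eq_card (Finset.union_subset_union hU hV)
  have e4 := Finset.card_sdiff_add_card_eq_card (Finset.inter_subset_inter hU hV)
  have e5 := Finset.card_union_add_card_inter A B
  have e6 := Finset.card_union_add_card_inter U V
  have e7 := Finset.card_union_add_card_inter (propsOn n P U) (propsOn n P V)
  have h3 : (propsOn n P (U ∪ V)).card ≤ (propsOn n P U ∪ propsOn n P V).card := by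
    refine Finset.card_le_card fun p hp => ?_
    obtain ⟨hp, x, hx, hxp⟩ := mem_propsOn.1 hp
    rcases Finset.mem_union.1 hx with hx | hx
    · exact Finset.mem_union_left _ (mem_propsOn.2 ⟨hp, x, hx, hxp⟩)
    · exact Finset.mem_union_right _ (mem_propsOn.2 ⟨hp, x, hx, hxp⟩)
  have h4 : (propsOn n P (U ∩ V)).card ≤ (propsOn n P U ∩ propsOn n P V).card :=
    Finset.card_le_card (Finset.subset_inter (propsOn_mono Finset.inter_subset_left)
      (propsOn_mono Finset.inter_subset_right))
  omega

theorem vrank_mono (P : Finset (Prp n)) {A B : Finset (ZMod n)} (h : A ⊆ B) :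
    vrank P A ≤ vrank P B := by
  obtain ⟨U, hU, hUe⟩ := exists_vrank_eq P B
  rw [hUe]
  refine (vrank_le (U := U ∩ A) Finset.inter_subset_right).trans (Nat.add_le_add
    (Finset.card_le_card (propsOn_mono Finset.inter_subset_left)) (Finset.card_le_card ?_))
  intro x hx
  simp only [Finset.mem_sdiff, Finset.mem_inter] at hx ⊢
  exact ⟨h hx.1, fun hxU => hx.2 ⟨hxU, hx.1⟩⟩

theorem vrank_insert_le (P : Finset (Prp n)) (x : ZMod n) (A : Finset (ZMod n)) :
    vrank P (insert x A) ≤ vrank P A + 1 := by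
  obtain ⟨U, hU, hUe⟩ := exists_vrank_eq P A
  refine (vrank_le (hU.trans (Finset.subset_insert x A))).trans ?_
  have : (insert x A \ U).card ≤ (A \ U).card + 1 := by
    refine (Finset.card_le_card (t := insert x (A \ U)) fun y hy => ?_).trans
      (Finset.card_insert_le _ _)
    simp only [Finset.mem_sdiff, Finset.mem_insert] at hy ⊢
    tauto
  omega

theorem vrank_empty (P : Finset (Prp n)) : vrank P ∅ = 0 := by
  have := vrank_le (P := P) (S := ∅) (U := ∅) subset_rfl
  have h : propsOn n P ∅ = ∅ := by ext p; simp [mem_propsOn]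
  simpa [h] using this

theorem vrank_image_le {P Q : Finset (Prp n)} {σ : ZMod n → ZMod n} {τ : Prp n → Prp n}
    (hσ : Function.Injective σ)
    (hQ : Q = P.image τ) (hτ : ∀ p, supp n (τ p) = (supp n p).image σ) (S : Finset (ZMod n)) :
    vrank Q (S.image σ) ≤ vrank P S := by
  obtain ⟨U, hU, hUe⟩ := exists_vrank_eq P S
  rw [hUe]
  refine (vrank_le (Finset.image_subset_image hU)).trans (Nat.add_le_add ?_ ?_)
  · refine (Finset.card_le_card (t := (propsOn n P U).image τ) fun q hq => ?_).trans
      Finset.card_image_le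
    obtain ⟨hq, x, hx, hxq⟩ := mem_propsOn.1 hq
    rw [hQ] at hq
    obtain ⟨p, hp, rfl⟩ := Finset.mem_image.1 hq
    obtain ⟨y, hy, rfl⟩ := Finset.mem_image.1 hx
    rw [hτ, hσ.mem_finset_image] at hxq
    exact Finset.mem_image_of_mem _ (mem_propsOn.2 ⟨hp, y, hy, hxq⟩)
  · rw [← Finset.image_sdiff _ _ hσ]
    exact Finset.card_image_le

/-- The cyclic interval of `t` vertices starting at `i`. -/
noncomputable def cint (i : ZMod n) (t : ℕ) : Finset (ZMod n) :=
  (Finset.range t).image fun u : ℕ => i + (u : ZMod n)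

theorem mem_cint {i x : ZMod n} {t : ℕ} : x ∈ cint i t ↔ ∃ u < t, i + (u : ZMod n) = x := by
  simp only [cint, Finset.mem_image, Finset.mem_range]

theorem cint_succ (i : ZMod n) (t : ℕ) : cint i (t + 1) = insert (i + (t : ZMod n)) (cint i t) := by
  simp [cint, Finset.range_add_one, Finset.image_insert]

theorem cint_succ' (i : ZMod n) (t : ℕ) : cint i (t + 1) = insert i (cint (i + 1) t) := by
  ext x
  simp only [mem_cint, Finset.mem_insert]
  constructor
  · rintro ⟨u, hu, rfl⟩
    cases u with
    | zero => simp
    | succ u => exact Or.inr ⟨u, by omega, by push_cast; ring⟩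
  · rintro (rfl | ⟨u, hu, rfl⟩)
    · exact ⟨0, by omega, by simp⟩
    · exact ⟨u + 1, by omega, by push_cast; ring⟩

theorem cint_eq_univ [NeZero n] (i : ZMod n) {t : ℕ} (ht : n ≤ t) : cint i t = Finset.univ := by
  ext x
  simp only [mem_cint, Finset.mem_univ, iff_true]
  exact ⟨(x - i).val, (ZMod.val_lt _).trans_le ht, by simp⟩

/-- The rank of the cyclic interval of `t` vertices starting at `i`. -/
noncomputable def irank (P : Finset (Prp n)) (i : ZMod n) (t : ℕ) : ℕ := vrank P (cint i t)

/-- The properties of the ranks of cyclic intervals used to count plusses. -/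
structure IsIntervalRank [NeZero n] (k : ℕ) (r : ZMod n → ℕ → ℕ) : Prop where
  zero : ∀ i, r i 0 = 0
  mono_right : ∀ i t, r i t ≤ r i (t + 1)
  right_le : ∀ i t, r i (t + 1) ≤ r i t + 1
  mono_left : ∀ i t, r (i + 1) t ≤ r i (t + 1)
  left_le : ∀ i t, r i (t + 1) ≤ r (i + 1) t + 1
  submod : ∀ i t, r i (t + 2) + r (i + 1) t ≤ r i (t + 1) + r (i + 1) (t + 1)
  full : ∀ i t, n ≤ t → r i t = k

theorem isIntervalRank_irank [NeZero n] (P : Finset (Prp n)) :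
    IsIntervalRank (vrank P Finset.univ) (irank P) where
  zero i := by simp [irank, cint, vrank_empty]
  mono_right i t := vrank_mono P (by rw [cint_succ]; exact Finset.subset_insert _ _)
  right_le i t := by unfold irank; rw [cint_succ]; exact vrank_insert_le _ _ _
  mono_left i t := vrank_mono P (by rw [cint_succ']; exact Finset.subset_insert _ _)
  left_le i t := by unfold irank; rw [cint_succ']; exact vrank_insert_le _ _ _
  submod i t := by
    have h := vrank_submodular P (cint i (t + 1)) (cint (i + 1) (t + 1))
    have h1 : cint i (t + 2) ⊆ cint i (t + 1) ∪ cint (i + 1) (t + 1) := by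
      rw [cint_succ' i (t + 1)]
      refine Finset.insert_subset (Finset.mem_union_left _ ?_) Finset.subset_union_right
      rw [cint_succ']
      exact Finset.mem_insert_self _ _
    have h2 : cint (i + 1) t ⊆ cint i (t + 1) ∩ cint (i + 1) (t + 1) := by
      refine Finset.subset_inter ?_ ?_
      · rw [cint_succ']; exact Finset.subset_insert _ _
      · rw [cint_succ]; exact Finset.subset_insert _ _
    have := vrank_mono P h1
    have := vrank_mono P h2
    unfold irank
    omega
  full i t ht := by unfold irank; rw [cint_eq_univ i ht]

/-- `t` is the distance from `i` to its image under the bounded affine permutation. -/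
def Corner (r : ZMod n → ℕ → ℕ) (i : ZMod n) (t : ℕ) : Prop :=
  r i t = r (i + 1) (t - 1) + 1 ∧ r i (t + 1) = r (i + 1) t

/-- The sum of the ranks `r [i, f i]` over the non-loops `i`, `f` the bounded affine permutation. -/
noncomputable def cornerSum [NeZero n] (r : ZMod n → ℕ → ℕ) : ℕ :=
  ∑ t ∈ Finset.Icc 1 n, ∑ i : ZMod n, if Corner r i t then r (i + 1) t else 0

theorem cornerSum_rotate [NeZero n] {r r' : ZMod n → ℕ → ℕ} (c : ZMod n)
    (h : ∀ i t, r' (i + c) t = r i t) : cornerSum r = cornerSum r' := by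
  refine Finset.sum_congr rfl fun t _ => Fintype.sum_equiv (Equiv.addRight c) _ _ fun i => ?_
  have h' : ∀ t, r' (i + c + 1) t = r (i + 1) t := fun t => by rw [← h]; congr 1; ring
  simp only [Equiv.coe_addRight, Corner, h, h']
  congr

theorem cornerSum_reflect [NeZero n] {k : ℕ} {r r' : ZMod n → ℕ → ℕ} (hr : IsIntervalRank k r)
    (c : ZMod n) (h : ∀ i (t : ℕ), r' (c - i - (t : ZMod n) + 1) t = r i t) :
    cornerSum r = cornerSum r' := by
  refine Finset.sum_congr rfl fun t ht =>
    Fintype.sum_equiv (Equiv.subLeft (c - (t : ZMod n))) _ _ fun i => ?_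
  obtain ⟨s, rfl⟩ : ∃ s, t = s + 1 := ⟨t - 1, by have := (Finset.mem_Icc.1 ht).1; omega⟩
  have e1 : r' (c - (s + 1 : ℕ) - i) (s + 1) = r (i + 1) (s + 1) := by
    rw [← h]; congr 1; ring
  have e2 : r' (c - (s + 1 : ℕ) - i) (s + 2) = r i (s + 2) := by
    rw [← h]; congr 1; push_cast; ring
  have e3 : r' (c - (s + 1 : ℕ) - i + 1) s = r (i + 1) s := by
    rw [← h]; congr 1; push_cast; ring
  have e4 : r' (c - (s + 1 : ℕ) - i + 1) (s + 1) = r i (s + 1) := by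
    rw [← h]; congr 1; ring
  have h1 : r i (s + 1) ≤ r i (s + 2) := hr.mono_right i (s + 1)
  have h2 : r (i + 1) (s + 1) ≤ r i (s + 2) := hr.mono_left i (s + 1)
  have h3 := hr.right_le (i + 1) s
  have h4 : r i (s + 2) ≤ r i (s + 1) + 1 := hr.right_le i (s + 1)
  have h5 := hr.mono_left i s
  have h6 := hr.left_le i s
  simp only [Equiv.subLeft_apply, Corner, Nat.add_sub_cancel, e1, e2, e3, e4, add_assoc,
    one_add_one_eq_two]
  split_ifs <;> omega

theorem irank_image [NeZero n] {P Q : Finset (Prp n)} {σ : ZMod n ≃ ZMod n} {τ : Prp n ≃ Prp n}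
    (hQ : Q = P.image τ) (hτ : ∀ p, supp n (τ p) = (supp n p).image σ) (S : Finset (ZMod n)) :
    vrank Q (S.image σ) = vrank P S := by
  refine le_antisymm (vrank_image_le σ.injective hQ hτ S) ?_
  have h := vrank_image_le (P := Q) (Q := P) (σ := σ.symm) (τ := τ.symm) σ.symm.injective
    (by subst hQ; ext p; simp) (fun p => ?_) (S.image σ)
  · simpa [Finset.image_image] using h
  · have := hτ (τ.symm p)
    rw [Equiv.apply_symm_apply] at this
    rw [this, Finset.image_image]
    simp

/-- The action on propagators of a permutation of the edges. -/
def prpCongr (σ : ZMod n ≃ ZMod n) : Prp n ≃ Prp n where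
  toFun := Sym2.map σ
  invFun := Sym2.map σ.symm
  left_inv p := by simp [Sym2.map_map]
  right_inv p := by simp [Sym2.map_map]

theorem cornerSum_irank_dihedral [NeZero n] {P Q : Finset (Prp n)}
    (hdihedral : (∃ c : ZMod n, Q = P.image (Sym2.map fun e => e + c)) ∨
      (∃ c : ZMod n, Q = P.image (Sym2.map fun e => c - 1 - e))) :
    cornerSum (irank P) = cornerSum (irank Q) ∧
      vrank P Finset.univ = vrank Q Finset.univ := by
  rcases hdihedral with ⟨c, hQ⟩ | ⟨c, hQ⟩
  · have key := irank_image (P := P) (Q := Q) (σ := Equiv.addRight c)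
      (τ := prpCongr (Equiv.addRight c)) hQ fun p => by
        induction p using Sym2.ind with
        | _ x y =>
          simp [prpCongr, supp, Finset.image_insert, add_right_comm]
    refine ⟨cornerSum_rotate c fun i t => ?_, ?_⟩
    · unfold irank
      rw [← key]
      congr 1
      ext x
      simp only [mem_cint, Finset.mem_image, Equiv.coe_addRight]
      constructor
      · rintro ⟨u, hu, rfl⟩
        exact ⟨_, ⟨u, hu, rfl⟩, add_right_comm _ _ _⟩
      · rintro ⟨_, ⟨u, hu, rfl⟩, rfl⟩
        exact ⟨u, hu, add_right_comm _ _ _⟩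
    · rw [← key]
      congr 1
      simp
  · have key := irank_image (P := P) (Q := Q) (σ := Equiv.subLeft c)
      (τ := prpCongr (Equiv.subLeft (c - 1))) hQ fun p => by
        induction p using Sym2.ind with
        | _ x y =>
          ext z
          simp only [prpCongr, supp, Finset.image_insert, Equiv.coe_fn_mk, Sym2.map_mk,
            Sym2.lift_mk, Equiv.subLeft_apply, Finset.mem_insert, Finset.mem_singleton,
            Finset.image_singleton]
          have e1 : ∀ w : ZMod n, c - 1 - w + 1 = c - w := fun w => by ring
          have e2 : ∀ w : ZMod n, c - 1 - w = c - (w + 1) := fun w => by ring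
          rw [e1, e1, e2, e2]
          tauto
    refine ⟨cornerSum_reflect (isIntervalRank_irank P) c fun i (t : ℕ) => ?_, ?_⟩
    · unfold irank
      rw [← key]
      congr 1
      ext x
      simp only [mem_cint, Finset.mem_image, Equiv.subLeft_apply]
      constructor
      · rintro ⟨u, hu, rfl⟩
        refine ⟨_, ⟨(t - 1 - u : ℕ), by omega, rfl⟩, ?_⟩
        rw [Nat.cast_sub (by omega), Nat.cast_sub (by omega)]
        push_cast
        ring
      · rintro ⟨_, ⟨u, hu, rfl⟩, rfl⟩
        refine ⟨(t - 1 - u : ℕ), by omega, ?_⟩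
        rw [Nat.cast_sub (by omega), Nat.cast_sub (by omega)]
        push_cast
        ring
    · rw [← key]
      congr 1
      simp

end Rank

/-- A Grassmann necklace in linear coordinates: `I s` is the term starting at the vertex `s`, and
passing to `I (s + 1)` replaces `s` by `j s` (if `s ∈ I s`). -/
structure LinNecklace (n : ℕ) (I : ℕ → Finset ℕ) (j : ℕ → ℕ) : Prop where
  sub : ∀ s, I s ⊆ Finset.range n
  last : I n = I 0
  stay : ∀ s < n, s ∉ I s → I (s + 1) = I s
  not_mem : ∀ s < n, s ∈ I s → j s ∉ (I s).erase s
  step : ∀ s < n, s ∈ I s → I (s + 1) = insert (j s) ((I s).erase s)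

/-- The number of elements of `X` in the interval `(a, b]`. -/
noncomputable def cnt (X : Finset ℕ) (a b : ℕ) : ℕ := (X.filter fun x => a < x ∧ x ≤ b).card

theorem exists_rank_eq (A B : Finset ℕ) (h : A.card = B.card) :
    (∀ a ∈ A, ∃ b ∈ B, (A.filter fun x => a < x).card = (B.filter fun y => y < b).card) ∧
    (∀ b ∈ B, ∃ a ∈ A, (A.filter fun x => a < x).card = (B.filter fun y => y < b).card) := by
  have hA : Set.SurjOn (fun a => (A.filter fun x => a < x).card) A (Finset.range A.card) := by
    refine Finset.surjOn_of_injOn_of_card_le _ (fun a ha => ?_) (fun a ha a' ha' haa => ?_)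
      (by simp)
    · simp only [Finset.coe_range, Set.mem_Iio]
      refine Finset.card_lt_card (Finset.filter_ssubset.2 ⟨a, ha, lt_irrefl a⟩)
    · by_contra hne
      rcases lt_or_gt_of_ne hne with hlt | hlt
      · refine absurd haa (Finset.card_lt_card ?_).ne'
        refine (Finset.ssubset_iff_of_subset fun x hx => ?_).2 ⟨a', ?_, ?_⟩ <;> grind
      · refine absurd haa (Finset.card_lt_card ?_).ne
        refine (Finset.ssubset_iff_of_subset fun x hx => ?_).2 ⟨a, ?_, ?_⟩ <;> grind
  have hB : Set.SurjOn (fun b => (B.filter fun y => y < b).card) B (Finset.range B.card) := by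
    refine Finset.surjOn_of_injOn_of_card_le _ (fun a ha => ?_) (fun a ha a' ha' haa => ?_)
      (by simp)
    · simp only [Finset.coe_range, Set.mem_Iio]
      refine Finset.card_lt_card (Finset.filter_ssubset.2 ⟨a, ha, lt_irrefl a⟩)
    · by_contra hne
      rcases lt_or_gt_of_ne hne with hlt | hlt
      · refine absurd haa (Finset.card_lt_card ?_).ne
        refine (Finset.ssubset_iff_of_subset fun x hx => ?_).2 ⟨a, ?_, ?_⟩ <;> grind
      · refine absurd haa (Finset.card_lt_card ?_).ne'
        refine (Finset.ssubset_iff_of_subset fun x hx => ?_).2 ⟨a', ?_, ?_⟩ <;> grind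
  constructor
  · intro a ha
    obtain ⟨b, hb, hab⟩ := hB (a := (A.filter fun x => a < x).card) (by
      rw [← h]; simp only [Finset.coe_range, Set.mem_Iio]
      exact Finset.card_lt_card (Finset.filter_ssubset.2 ⟨a, ha, lt_irrefl a⟩))
    exact ⟨b, hb, hab.symm⟩
  · intro b hb
    obtain ⟨a, ha, hab⟩ := hA (a := (B.filter fun y => y < b).card) (by
      rw [h]; simp only [Finset.coe_range, Set.mem_Iio]
      exact Finset.card_lt_card (Finset.filter_ssubset.2 ⟨b, hb, lt_irrefl b⟩))
    exact ⟨a, ha, hab⟩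

/-- A plus in the box `(a, b)` placed by the necklace term `X` relative to `X₀`. -/
def Plus (X₀ X : Finset ℕ) (a b : ℕ) : Prop :=
  a ∈ X₀ \ X ∧ b ∈ X \ X₀ ∧
    ((X₀ \ X).filter fun x => a < x).card = ((X \ X₀).filter fun y => y < b).card

theorem Plus.eq_left_iff {X₀ X : Finset ℕ} {a b a' b' : ℕ} (h1 : Plus X₀ X a b)
    (h2 : Plus X₀ X a' b') : a = a' ↔ b = b' := by
  obtain ⟨ha, hb, he⟩ := h1
  obtain ⟨ha', hb', he'⟩ := h2
  have hA : ∀ x ∈ X₀ \ X, ∀ y ∈ X₀ \ X, x < y →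
      ((X₀ \ X).filter fun z => y < z).card < ((X₀ \ X).filter fun z => x < z).card := by
    intro x hx y hy hxy
    refine Finset.card_lt_card ((Finset.ssubset_iff_of_subset fun z hz => ?_).2 ⟨y, ?_, ?_⟩)
    · simp only [Finset.mem_filter] at hz ⊢
      exact ⟨hz.1, by omega⟩
    · exact Finset.mem_filter.2 ⟨hy, hxy⟩
    · simp
  have hB : ∀ x ∈ X \ X₀, ∀ y ∈ X \ X₀, x < y →
      ((X \ X₀).filter fun z => z < x).card < ((X \ X₀).filter fun z => z < y).card := by
    intro x hx y hy hxy
    refine Finset.card_lt_card ((Finset.ssubset_iff_of_subset fun z hz => ?_).2 ⟨x, ?_, ?_⟩)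
    · simp only [Finset.mem_filter] at hz ⊢
      exact ⟨hz.1, by omega⟩
    · exact Finset.mem_filter.2 ⟨hx, hxy⟩
    · simp
  constructor
  · rintro rfl
    rcases lt_trichotomy b b' with hlt | heq | hlt
    · have := hB b hb b' hb' hlt; omega
    · exact heq
    · have := hB b' hb' b hb hlt; omega
  · rintro rfl
    rcases lt_trichotomy a a' with hlt | heq | hlt
    · have := hA a ha a' ha' hlt; omega
    · exact heq
    · have := hA a' ha' a ha hlt; omega

namespace LinNecklace

variable {n : ℕ} {I : ℕ → Finset ℕ} {j : ℕ → ℕ} (h : LinNecklace n I j)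
include h

theorem card_succ {s : ℕ} (hs : s < n) : (I (s + 1)).card = (I s).card := by
  by_cases hm : s ∈ I s
  · rw [h.step s hs hm, Finset.card_insert_of_notMem (h.not_mem s hs hm)]
    exact Finset.card_erase_add_one hm
  · rw [h.stay s hs hm]

theorem card_eq {s : ℕ} (hs : s ≤ n) : (I s).card = (I 0).card := by
  induction s with
  | zero => rfl
  | succ s ih => rw [h.card_succ hs, ih (by omega)]

theorem mem_succ {s x : ℕ} (hs : s < n) (hx : x ∈ I s) (hne : x ≠ s) : x ∈ I (s + 1) := by
  by_cases hm : s ∈ I s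
  · rw [h.step s hs hm]
    exact Finset.mem_insert_of_mem (Finset.mem_erase.2 ⟨hne, hx⟩)
  · rwa [h.stay s hs hm]

theorem mem_of_mem_zero {s x : ℕ} (hs : s ≤ n) (hx : x ∈ I 0) (hsx : s ≤ x) : x ∈ I s := by
  induction s with
  | zero => exact hx
  | succ s ih => exact h.mem_succ hs (ih (by omega) (by omega)) (by omega)

theorem mem_mono {s m x : ℕ} (hsm : s ≤ m) (hm : m ≤ n) (hx : x ∈ I s) (hxs : x < s ∨ m ≤ x) :
    x ∈ I m := by
  induction m, hsm using Nat.le_induction with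
  | base => exact hx
  | succ m hsm ih => exact h.mem_succ (by omega) (ih (by omega) (by omega)) (by omega)

theorem mem_zero_of_mem {s x : ℕ} (hs : s ≤ n) (hx : x ∈ I s) (hxs : x < s) : x ∈ I 0 :=
  h.last ▸ h.mem_mono hs le_rfl hx (Or.inl hxs)

theorem plus_iff {s a b : ℕ} (hs : s ≤ n) : Plus (I 0) (I s) a b ↔
    a ∈ I 0 ∧ a ∉ I s ∧ b ∈ I s ∧ b ∉ I 0 ∧ a < s ∧ s ≤ b ∧
      ((I 0).filter fun x => a < x ∧ x < b).card = ((I s).filter fun x => a < x ∧ x < b).card := by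
  simp only [Plus, Finset.mem_sdiff]
  have key : a < s → s ≤ b →
      ((I 0 \ I s).filter fun x => a < x).card
        + ((I s).filter fun x => a < x ∧ x < b).card =
      ((I s \ I 0).filter fun x => x < b).card
        + ((I 0).filter fun x => a < x ∧ x < b).card := by
    intro ha hb
    have e1 : (I 0 \ I s).filter (fun x => a < x) =
        (I 0).filter (fun x => a < x ∧ x < b) \ (I s).filter (fun x => a < x ∧ x < b) := by
      ext x
      have := h.mem_of_mem_zero (x := x) hs
      simp only [Finset.mem_filter, Finset.mem_sdiff]
      grind
    have e2 : (I s \ I 0).filter (fun x => x < b) =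
        (I s).filter (fun x => a < x ∧ x < b) \ (I 0).filter (fun x => a < x ∧ x < b) := by
      ext x
      have := h.mem_zero_of_mem (x := x) hs
      simp only [Finset.mem_filter, Finset.mem_sdiff]
      grind
    rw [e1, e2, Finset.card_sdiff_add_card, Finset.card_sdiff_add_card, Finset.union_comm]
  have h1 : a ∈ I 0 → a ∉ I s → a < s := fun ha ha' => by
    by_contra hge
    exact ha' (h.mem_of_mem_zero hs ha (by omega))
  have h2 : b ∈ I s → b ∉ I 0 → s ≤ b := fun ha ha' => by
    by_contra hge
    exact ha' (h.mem_zero_of_mem hs ha (by omega))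
  constructor
  · rintro ⟨⟨ha, ha'⟩, ⟨hb, hb'⟩, he⟩
    have := key (h1 ha ha') (h2 hb hb')
    exact ⟨ha, ha', hb, hb', h1 ha ha', h2 hb hb', by omega⟩
  · rintro ⟨ha, ha', hb, hb', has, hbs, he⟩
    have := key has hbs
    exact ⟨⟨ha, ha'⟩, ⟨hb, hb'⟩, by omega⟩

/-- One step changes the number of elements in an open interval around `s` as expected. -/
theorem card_between_succ {s a b : ℕ} (hs : s < n) (hm : s ∈ I s) (ha : a < s) (hb : s < b) :
    ((I (s + 1)).filter fun x => a < x ∧ x < b).card + 1 =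
      ((I s).filter fun x => a < x ∧ x < b).card + if a < j s ∧ j s < b then 1 else 0 := by
  have hj := h.not_mem s hs hm
  rw [h.step s hs hm, Finset.filter_insert, Finset.filter_erase]
  have hms : s ∈ (I s).filter fun x => a < x ∧ x < b := Finset.mem_filter.2 ⟨hm, ha, hb⟩
  have := Finset.card_erase_add_one hms
  split_ifs with hc
  · rw [Finset.card_insert_of_notMem]
    · omega
    · rw [← Finset.filter_erase]
      exact fun hx => hj (Finset.mem_filter.1 hx).1
  · omega

theorem card_between_anti {s m a b : ℕ} (ha : a < s) (hsm : s ≤ m) (hm : m ≤ n) (hb : m ≤ b) :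
    ((I m).filter fun x => a < x ∧ x < b).card ≤ ((I s).filter fun x => a < x ∧ x < b).card := by
  induction m, hsm using Nat.le_induction with
  | base => exact le_rfl
  | succ m hsm ih =>
    refine le_trans ?_ (ih (by omega) (by omega))
    by_cases hmm : m ∈ I m
    · have := h.card_between_succ (a := a) (b := b) (s := m) (by omega) hmm (by omega) (by omega)
      split_ifs at this <;> omega
    · rw [h.stay m (by omega) hmm]

/-- A plus that was placed earlier was also placed by the previous term. -/
theorem plus_pred {s s' a b : ℕ} (hs : s < n) (hs' : s' ≤ s) (h' : Plus (I 0) (I s') a b)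
    (h1 : Plus (I 0) (I (s + 1)) a b) : Plus (I 0) (I s) a b := by
  rw [h.plus_iff (by omega)] at h' h1 ⊢
  obtain ⟨ha, ha', hb, hb', has, hbs, he⟩ := h'
  obtain ⟨-, ha1, hb1, -, has1, hbs1, he1⟩ := h1
  have e1 := h.card_between_anti (a := a) (b := b) has hs' (by omega) (by omega)
  have e2 := h.card_between_anti (s := s) (m := s + 1) (a := a) (b := b) (by omega) (by omega)
    (by omega) (by omega)
  refine ⟨ha, fun hx => ha1 (h.mem_succ hs hx (by omega)), ?_, hb', by omega, by omega, by omega⟩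
  exact h.mem_mono hs' (by omega) hb (by omega)

theorem new_plus_iff {s a b : ℕ} (hs : s < n) (h1 : Plus (I 0) (I (s + 1)) a b) :
    ¬ Plus (I 0) (I s) a b ↔ s ∈ I s ∧ if j s ≤ s then j s < a else b ≤ j s := by
  by_cases hm : s ∈ I s
  swap
  · rw [h.stay s hs hm] at h1
    simp [hm, h1]
  rw [h.plus_iff (by omega)] at h1 ⊢
  obtain ⟨ha, ha1, hb1, hb, has, hbs, he⟩ := h1
  have hc := fun hlt => h.card_between_succ (a := a) (b := b) hs hm hlt (by omega)
  have hj := h.not_mem s hs hm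
  rw [h.step s hs hm] at ha1 hb1
  simp only [Finset.mem_insert, Finset.mem_erase] at ha1 hb1 hj
  push Not at ha1
  have hsb : s < b := by omega
  simp only [hm, true_and, ha, hb, not_false_eq_true]
  rcases Nat.lt_or_ge a s with hlt | hge
  · have hc := hc hlt
    have haI : a ∉ I s := ha1.2 (by omega)
    simp only [haI, not_false_eq_true, hlt, true_and]
    by_cases hbj : b = j s
    · subst hbj
      have : j s ∉ I s := fun hx => hj ⟨by omega, hx⟩
      simp [this]
      omega
    · have hbI : b ∈ I s := by tauto
      have := ha1.1
      simp only [hbI, true_and]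
      split_ifs at hc ⊢ <;> omega
  · obtain rfl : a = s := by omega
    simp only [lt_irrefl, false_and, and_false, not_false_eq_true, true_iff]
    have := ha1.1
    split_ifs
    · omega
    · by_contra hlt
      have hpos : 0 < ((I (a + 1)).filter fun x => a < x ∧ x < b).card := by
        refine Finset.card_pos.2 ⟨j a, Finset.mem_filter.2 ⟨?_, by omega, by omega⟩⟩
        rw [h.step a hs hm]
        exact Finset.mem_insert_self _ _
      have hsub : ((I 0).filter fun x => a < x ∧ x < b).card <
          ((I (a + 1)).filter fun x => a < x ∧ x < b).card := by
        refine Finset.card_lt_card ((Finset.ssubset_iff_of_subset fun x hx => ?_).2 ⟨j a, ?_, ?_⟩)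
        · obtain ⟨hx0, hx1, hx2⟩ := Finset.mem_filter.1 hx
          exact Finset.mem_filter.2 ⟨h.mem_of_mem_zero hs hx0 (by omega), hx1, hx2⟩
        · refine Finset.mem_filter.2 ⟨?_, by omega, by omega⟩
          rw [h.step a hs hm]
          exact Finset.mem_insert_self _ _
        · intro hx
          have := h.mem_of_mem_zero (s := a) (by omega) (Finset.mem_filter.1 hx).1 (by omega)
          exact hj ⟨by omega, this⟩
      omega

/-- The plusses placed by the terms up to `I s`. -/
noncomputable def _root_.WLD.plusses (n : ℕ) (I : ℕ → Finset ℕ) (s : ℕ) : Finset (ℕ × ℕ) :=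
  (Finset.range n ×ˢ Finset.range n).filter fun ab => ∃ s' ≤ s, Plus (I 0) (I s') ab.1 ab.2

/-- The plusses placed by `I (s + 1)` but not by earlier terms. -/
noncomputable def _root_.WLD.newPlusses (n : ℕ) (I : ℕ → Finset ℕ) (s : ℕ) : Finset (ℕ × ℕ) :=
  (Finset.range n ×ˢ Finset.range n).filter fun ab =>
    Plus (I 0) (I (s + 1)) ab.1 ab.2 ∧ ¬ Plus (I 0) (I s) ab.1 ab.2

theorem card_plusses_succ {s : ℕ} (hs : s < n) :
    (plusses n I (s + 1)).card = (plusses n I s).card + (newPlusses n I s).card := by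
  rw [← Finset.card_union_of_disjoint]
  · congr 1
    ext ⟨a, b⟩
    simp only [plusses, newPlusses, Finset.mem_union, Finset.mem_filter, ← and_or_left]
    refine and_congr_right fun _ => ⟨?_, ?_⟩
    · rintro ⟨s', hs', hp⟩
      rcases Nat.lt_or_ge s s' with hlt | hge
      · obtain rfl : s' = s + 1 := by omega
        by_cases hq : Plus (I 0) (I s) a b
        · exact Or.inl ⟨s, le_rfl, hq⟩
        · exact Or.inr ⟨hp, hq⟩
      · exact Or.inl ⟨s', hge, hp⟩
    · rintro (⟨s', hs', hp⟩ | ⟨hp, -⟩)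
      · exact ⟨s', by omega, hp⟩
      · exact ⟨s + 1, le_rfl, hp⟩
  · rw [Finset.disjoint_left]
    rintro ⟨a, b⟩ h1 h2
    simp only [plusses, newPlusses, Finset.mem_filter] at h1 h2
    obtain ⟨-, s', hs', hp⟩ := h1
    exact h2.2.2 (h.plus_pred hs hs' hp h2.2.1)

theorem card_sdiff_eq {s : ℕ} (hs : s ≤ n) : (I 0 \ I s).card = (I s \ I 0).card := by
  have := Finset.card_sdiff_add_card (I 0) (I s)
  have := Finset.card_sdiff_add_card (I s) (I 0)
  rw [Finset.union_comm] at this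
  have := h.card_eq hs
  omega

theorem card_newPlusses {s : ℕ} (hs : s < n) (hm : s ∈ I s) :
    (newPlusses n I s).card = if j s ≤ s
      then ((I 0 \ I (s + 1)).filter fun a => j s < a).card
      else ((I (s + 1) \ I 0).filter fun b => b ≤ j s).card := by
  have hmem : ∀ a b, (a, b) ∈ newPlusses n I s ↔
      Plus (I 0) (I (s + 1)) a b ∧ if j s ≤ s then j s < a else b ≤ j s := by
    intro a b
    simp only [newPlusses, Finset.mem_filter, Finset.mem_product]
    constructor
    · rintro ⟨-, h1, h2⟩
      exact ⟨h1, ((h.new_plus_iff hs h1).1 h2).2⟩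
    · rintro ⟨h1, h2⟩
      exact ⟨⟨h.sub _ (Finset.mem_sdiff.1 h1.1).1, h.sub _ (Finset.mem_sdiff.1 h1.2.1).1⟩, h1,
        (h.new_plus_iff hs h1).2 ⟨hm, h2⟩⟩
  obtain ⟨hA, hB⟩ := exists_rank_eq _ _ (h.card_sdiff_eq (s := s + 1) hs)
  split_ifs with hw
  · simp only [hw, if_true] at hmem
    refine Finset.card_bij (fun ab _ => ab.1) ?_ ?_ ?_
    · rintro ⟨a, b⟩ hab
      obtain ⟨h1, h2⟩ := (hmem a b).1 hab
      exact Finset.mem_filter.2 ⟨h1.1, h2⟩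
    · rintro ⟨a, b⟩ hab ⟨a', b'⟩ hab' haa
      have := (Plus.eq_left_iff ((hmem a b).1 hab).1 ((hmem a' b').1 hab').1).1 haa
      exact Prod.ext haa this
    · intro a ha
      obtain ⟨ha, hja⟩ := Finset.mem_filter.1 ha
      obtain ⟨b, hb, he⟩ := hA a ha
      exact ⟨(a, b), (hmem a b).2 ⟨⟨ha, hb, he⟩, hja⟩, rfl⟩
  · simp only [hw, if_false] at hmem
    refine Finset.card_bij (fun ab _ => ab.2) ?_ ?_ ?_
    · rintro ⟨a, b⟩ hab
      obtain ⟨h1, h2⟩ := (hmem a b).1 hab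
      exact Finset.mem_filter.2 ⟨h1.2.1, h2⟩
    · rintro ⟨a, b⟩ hab ⟨a', b'⟩ hab' hbb
      have := (Plus.eq_left_iff ((hmem a b).1 hab).1 ((hmem a' b').1 hab').1).2 hbb
      exact Prod.ext this hbb
    · intro b hb
      obtain ⟨hb, hjb⟩ := Finset.mem_filter.1 hb
      obtain ⟨a, ha, he⟩ := hB b hb
      exact ⟨(a, b), (hmem a b).2 ⟨⟨ha, hb, he⟩, hjb⟩, rfl⟩

omit h in
theorem _root_.WLD.cnt_add (X : Finset ℕ) {a b : ℕ} (hab : a ≤ b) :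
    cnt X a b + (X.filter fun x => x ≤ a).card = (X.filter fun x => x ≤ b).card := by
  unfold cnt
  rw [← Finset.card_union_of_disjoint]
  · congr 1
    ext x
    simp only [Finset.mem_union, Finset.mem_filter]
    grind
  · rw [Finset.disjoint_left]
    intro x
    simp only [Finset.mem_filter]
    omega

/-- The number of elements of `I (s + 1)` on the cyclic interval from `s + 1` to `j s`. -/
noncomputable def _root_.WLD.cycCount (I : ℕ → Finset ℕ) (j : ℕ → ℕ) (s : ℕ) : ℕ :=
  if s ∈ I s then
    if j s ≤ s then (I 0).card - cnt (I (s + 1)) (j s) s else cnt (I (s + 1)) s (j s)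
  else 0

theorem card_newPlusses_add {s : ℕ} (hs : s < n) :
    (newPlusses n I s).card
      + (I 0).card * ((I (s + 1)).filter fun x => x < s + 1).card
      + ∑ x ∈ I (s + 1), ((I 0).filter fun y => y ≤ x).card
    = cycCount I j s + (I 0).card * ((I s).filter fun x => x < s).card
      + ∑ x ∈ I s, ((I 0).filter fun y => y ≤ x).card := by
  have hlt : ∀ x, x < s + 1 ↔ x ≤ s := fun x => Nat.lt_succ_iff
  by_cases hm : s ∈ I s
  swap
  · have e1 : newPlusses n I s = ∅ := by
      simp only [newPlusses, h.stay s hs hm, and_not_self_iff, Finset.filter_false]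
    have e2 : ((I s).filter fun x => x < s + 1) = (I s).filter fun x => x < s := by
      ext x
      simp only [Finset.mem_filter]
      refine and_congr_right fun hx => ?_
      have : x ≠ s := fun hxs => hm (hxs ▸ hx)
      omega
    rw [e1, h.stay s hs hm, e2]
    simp [cycCount, hm]
  · have hj := h.not_mem s hs hm
    have eS : ∑ x ∈ I (s + 1), ((I 0).filter fun y => y ≤ x).card
        + ((I 0).filter fun y => y ≤ s).card =
        ∑ x ∈ I s, ((I 0).filter fun y => y ≤ x).card + ((I 0).filter fun y => y ≤ j s).card := by
      rw [h.step s hs hm, Finset.sum_insert hj, add_assoc, Finset.sum_erase_add _ _ hm, add_comm]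
    have eW : ((I (s + 1)).filter fun x => x < s + 1).card =
        ((I s).filter fun x => x < s).card + if j s ≤ s then 1 else 0 := by
      have e : ((I s).erase s).filter (fun x => x < s + 1) = (I s).filter fun x => x < s := by
        ext x
        simp only [Finset.mem_filter, Finset.mem_erase]
        grind
      rw [h.step s hs hm, Finset.filter_insert, e]
      simp only [hlt]
      split_ifs with hw
      · rw [Finset.card_insert_of_notMem]
        rw [← e]
        exact fun hx => hj (Finset.mem_filter.1 hx).1
      · rfl
    rw [eW, h.card_newPlusses hs hm]
    simp only [cycCount, hm, if_true]
    split_ifs with hw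
    · have e1 : (I 0 \ I (s + 1)).filter (fun a => j s < a) =
          ((I 0).filter fun x => j s < x ∧ x ≤ s) \
            (I (s + 1)).filter fun x => j s < x ∧ x ≤ s := by
        ext x
        have := h.mem_of_mem_zero (x := x) (s := s + 1) hs
        simp only [Finset.mem_filter, Finset.mem_sdiff]
        grind
      have hsub : ((I (s + 1)).filter fun x => j s < x ∧ x ≤ s) ⊆
          (I 0).filter fun x => j s < x ∧ x ≤ s := by
        intro x hx
        obtain ⟨hx, hx'⟩ := Finset.mem_filter.1 hx
        exact Finset.mem_filter.2 ⟨h.mem_zero_of_mem hs hx (by omega), hx'⟩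
      have e2 := Finset.card_sdiff_add_card_eq_card hsub
      have e3 := cnt_add (I 0) hw
      have e4 : cnt (I (s + 1)) (j s) s ≤ (I 0).card :=
        (Finset.card_le_card hsub).trans (Finset.card_filter_le _ _)
      rw [e1]
      unfold cnt at *
      rw [mul_add, mul_one]
      omega
    · have e1 : (I (s + 1) \ I 0).filter (fun b => b ≤ j s) =
          ((I (s + 1)).filter fun x => s < x ∧ x ≤ j s) \
            (I 0).filter fun x => s < x ∧ x ≤ j s := by
        ext x
        have := h.mem_zero_of_mem (x := x) (s := s + 1) hs
        simp only [Finset.mem_filter, Finset.mem_sdiff]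
        grind
      have hsub : ((I 0).filter fun x => s < x ∧ x ≤ j s) ⊆
          (I (s + 1)).filter fun x => s < x ∧ x ≤ j s := by
        intro x hx
        obtain ⟨hx, hx'⟩ := Finset.mem_filter.1 hx
        exact Finset.mem_filter.2 ⟨h.mem_of_mem_zero hs hx (by omega), hx'⟩
      have e2 := Finset.card_sdiff_add_card_eq_card hsub
      have e3 := cnt_add (I 0) (a := s) (b := j s) (by omega)
      rw [e1]
      unfold cnt at *
      rw [add_zero]
      omega

theorem card_plusses_add_sq :
    (plusses n I n).card + (I 0).card * (I 0).card = ∑ s ∈ Finset.range n, cycCount I j s := by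
  have key : ∀ s ≤ n, (plusses n I s).card + (I 0).card * ((I s).filter fun x => x < s).card
      + ∑ x ∈ I s, ((I 0).filter fun y => y ≤ x).card =
      ∑ s' ∈ Finset.range s, cycCount I j s' + ∑ x ∈ I 0, ((I 0).filter fun y => y ≤ x).card := by
    intro s hs
    induction s with
    | zero => simp [plusses, Plus]
    | succ s ih =>
      have h1 := h.card_newPlusses_add hs
      have h2 := h.card_plusses_succ hs
      have := ih (by omega)
      rw [Finset.sum_range_succ]
      omega
  have h1 := key n le_rfl
  have h2 : ((I n).filter fun x => x < n) = I 0 := by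
    rw [h.last, Finset.filter_eq_self]
    exact fun x hx => Finset.mem_range.1 (h.sub 0 hx)
  rw [h2, h.last] at h1
  omega

end LinNecklace

section Positions

variable {n : ℕ} [NeZero n]

omit [NeZero n] in
theorem natCast_inj_of_lt {a b : ℕ} (ha : a < n) (hb : b < n) (h : (a : ZMod n) = b) : a = b := by
  have := congrArg ZMod.val h
  rwa [ZMod.val_natCast_of_lt ha, ZMod.val_natCast_of_lt hb] at this

omit [NeZero n] in
theorem ord_add_add (c : ZMod n) {a b : ℕ} (ha : a < n) (hb : b < n) :
    ord n (c + a) (c + b) = if a ≤ b then b - a else b + n - a := by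
  unfold ord
  rw [add_sub_add_left_eq_sub]
  split_ifs with hab
  · rw [← Nat.cast_sub hab, ZMod.val_natCast_of_lt (by omega)]
  · have : (b : ZMod n) - a = ((b + n - a : ℕ) : ZMod n) := by
      rw [Nat.cast_sub (by omega)]; simp
    rw [this, ZMod.val_natCast_of_lt (by omega)]

/-- The position of the first edge of `p` met when visiting the vertices from `i` on. -/
def loPos (i : ZMod n) (p : Prp n) : ℕ :=
  Sym2.lift ⟨fun x y => min (ord n (i - 1) x) (ord n (i - 1) y), fun _ _ => min_comm _ _⟩ p

/-- The position of the second edge of `p` met when visiting the vertices from `i` on. -/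
def hiPos (i : ZMod n) (p : Prp n) : ℕ :=
  Sym2.lift ⟨fun x y => max (ord n (i - 1) x) (ord n (i - 1) y), fun _ _ => max_comm _ _⟩ p

theorem add_ord (i x : ZMod n) : i + (ord n i x : ZMod n) = x := by
  simp [ord]

theorem loPos_hiPos_spec (i : ZMod n) (p : Prp n) : loPos i p ≤ hiPos i p ∧ hiPos i p < n ∧
    p = s(i - 1 + (loPos i p : ZMod n), i - 1 + (hiPos i p : ZMod n)) := by
  induction p using Sym2.ind with
  | _ x y =>
  have hx : ord n (i - 1) x < n := ZMod.val_lt _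
  have hy : ord n (i - 1) y < n := ZMod.val_lt _
  simp only [loPos, hiPos, Sym2.lift_mk]
  refine ⟨min_le_max, max_lt hx hy, ?_⟩
  rcases le_total (ord n (i - 1) x) (ord n (i - 1) y) with h | h
  · rw [min_eq_left h, max_eq_right h, add_ord, add_ord]
  · rw [min_eq_right h, max_eq_left h, add_ord, add_ord, Sym2.eq_swap]

omit [NeZero n] in
theorem otherEnd_left {x y : ZMod n} : otherEnd n s(x, y) x = y := by
  have hx : x ∈ s(x, y) := Sym2.mem_mk_left x y
  have := Sym2.other_spec hx
  rw [otherEnd, dif_pos hx]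
  exact Sym2.congr_right.1 this

omit [NeZero n] in
theorem otherEnd_right {x y : ZMod n} : otherEnd n s(x, y) y = x := by
  rw [Sym2.eq_swap, otherEnd_left]

omit [NeZero n] in
theorem mem_supp_mk {x y v : ZMod n} :
    v ∈ supp n s(x, y) ↔ v = x ∨ v = x + 1 ∨ v = y ∨ v = y + 1 := by
  simp [supp]

omit [NeZero n] in
theorem pos_eq_pred_iff {i : ZMod n} {u a : ℕ} (hu : u < n) (ha : a < n) :
    i + (u : ZMod n) = i - 1 + (a : ZMod n) ↔ u + 1 = a ∨ (a = 0 ∧ u + 1 = n) := by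
  have e : i + (u : ZMod n) = i - 1 + (a : ZMod n) ↔ ((u + 1 : ℕ) : ZMod n) = a := by
    push_cast
    constructor <;> intro h
    · linear_combination h
    · linear_combination h
  rw [e]
  constructor
  · intro h
    rcases Nat.lt_or_ge (u + 1) n with hlt | hge
    · exact Or.inl (natCast_inj_of_lt hlt ha h)
    · have hn : u + 1 = n := by omega
      rw [hn] at h
      refine Or.inr ⟨(natCast_inj_of_lt ha (by omega) ?_), hn⟩
      rw [← h]; simp
  · rintro (rfl | ⟨rfl, h⟩)
    · rfl
    · rw [h]; simp

omit [NeZero n] in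
theorem pos_eq_iff {i : ZMod n} {u a : ℕ} (hu : u < n) (ha : a < n) :
    i + (u : ZMod n) = i + (a : ZMod n) ↔ u = a :=
  ⟨fun h => natCast_inj_of_lt hu ha (add_left_cancel h), fun h => by rw [h]⟩

/-- The Grassmann necklace algorithm from `i`, in linear coordinates. -/
noncomputable def gnSweep (P : Finset (Prp n)) (i : ZMod n) : Sweep (Prp n) n where
  P := P
  lo := loPos i
  hi := hiPos i
  R t := (gnRun n P i t).1
  pk t := pickCW n (gnRun n P i t).1 (i + (t : ZMod n))

theorem sup_iff {P : Finset (Prp n)} {i : ZMod n} {p : Prp n}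
    (hgap : loPos i p + 2 ≤ hiPos i p) {u : ℕ} (hu : u < n) :
    (gnSweep P i).Sup p u ↔ i + (u : ZMod n) ∈ supp n p := by
  obtain ⟨hle, hlt, hp⟩ := loPos_hiPos_spec i p
  have key : ∀ a b : ℕ, a + 2 ≤ b → b < n → ((i + (u : ZMod n) ∈
      supp n s(i - 1 + (a : ZMod n), i - 1 + (b : ZMod n))) ↔
      (u + 1 = a ∨ u = a ∨ u + 1 = b ∨ u = b ∨ (a = 0 ∧ u + 1 = n))) := by
    intro a b hab hb
    have e : ∀ c : ZMod n, i - 1 + c + 1 = i + c := fun c => by ring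
    rw [mem_supp_mk, e, e, pos_eq_iff hu hb, pos_eq_iff hu (by omega),
      pos_eq_pred_iff hu hb, pos_eq_pred_iff hu (by omega)]
    omega
  conv_rhs => rw [hp]
  rw [key _ _ hgap hlt]
  rfl

theorem key_eq {P : Finset (Prp n)} {i : ZMod n} {p : Prp n}
    (hgap : loPos i p + 2 ≤ hiPos i p) {u : ℕ} (hu : u < n) (hs : (gnSweep P i).Sup p u) :
    (gnSweep P i).key u p = cwKey n (i + (u : ZMod n)) p := by
  obtain ⟨hle, hlt, hp⟩ := loPos_hiPos_spec i p
  have key : ∀ a b : ℕ, a + 2 ≤ b → b < n →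
      (u + 1 = a ∨ u = a ∨ u + 1 = b ∨ u = b ∨ (a = 0 ∧ u + 1 = n)) →
      cwKey n (i + (u : ZMod n)) s(i - 1 + (a : ZMod n), i - 1 + (b : ZMod n)) =
      if u = a then n + (b - a) else if u = b then n + (a + n - b)
        else if u + 1 = b then a + n - b else b - a := by
    intro a b hab hb hs
    have ha : a < n := by omega
    have e : i + (u : ZMod n) - 1 = i - 1 + u := by ring
    have emem : i + (u : ZMod n) - 1 ∈ s(i - 1 + (a : ZMod n), i - 1 + (b : ZMod n)) ↔
        u = a ∨ u = b := by
      rw [Sym2.mem_iff, e, pos_eq_iff hu hb, pos_eq_iff hu ha]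
    unfold cwKey
    by_cases h1 : u = a
    · subst h1
      rw [if_pos (emem.2 (Or.inl rfl)), e, otherEnd_left, ord_add_add _ hu hb]
      simp; omega
    by_cases h2 : u = b
    · subst h2
      rw [if_pos (emem.2 (Or.inr rfl)), e, otherEnd_right, ord_add_add _ hu ha]
      simp [h1]; omega
    rw [if_neg (by rw [emem]; tauto), if_neg h1, if_neg h2]
    by_cases h3 : u + 1 = b
    · rw [(pos_eq_pred_iff hu hb).2 (Or.inl h3), otherEnd_right, ord_add_add _ hb ha]
      simp [h3]; omega
    · rw [(pos_eq_pred_iff hu ha).2 (by omega), otherEnd_left, ord_add_add _ ha hb]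
      simp [h3]; omega
  conv_rhs => rw [hp]
  rw [key _ _ hgap hlt hs]
  rfl

omit [NeZero n] in
theorem pickCW_eq_none {S : Finset (Prp n)} {a : ZMod n} (h : pickCW n S a = none) :
    ∀ p ∈ S, a ∉ supp n p := by
  unfold pickCW at h
  split_ifs at h with hne
  intro p hp ha
  exact hne ⟨p, Finset.mem_filter.2 ⟨hp, ha⟩⟩

omit [NeZero n] in
theorem pickCW_eq_some {S : Finset (Prp n)} {a : ZMod n} {p : Prp n} (h : pickCW n S a = some p) :
    (p ∈ S ∧ a ∈ supp n p) ∧ ∀ q ∈ S, a ∈ supp n q → cwKey n a q ≤ cwKey n a p := by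
  unfold pickCW at h
  split_ifs at h with hne
  obtain ⟨h1, h2⟩ := Classical.choose_spec
    ((S.filter fun p => a ∈ supp n p).exists_max_image (cwKey n a) hne)
  rw [Option.some.inj h] at h1 h2
  exact ⟨Finset.mem_filter.1 h1, fun q hq ha => h2 q (Finset.mem_filter.2 ⟨hq, ha⟩)⟩

omit [NeZero n] in
theorem gnRun_succ_none {P : Finset (Prp n)} {i : ZMod n} {t : ℕ}
    (h : (gnSweep P i).pk t = none) : gnRun n P i (t + 1) = gnRun n P i t := by
  simp only [gnSweep] at h
  simp [gnRun, h]

omit [NeZero n] in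
theorem gnRun_succ_some {P : Finset (Prp n)} {i : ZMod n} {t : ℕ} {p : Prp n}
    (h : (gnSweep P i).pk t = some p) : gnRun n P i (t + 1) = ((gnRun n P i t).1.erase p,
      Function.update (gnRun n P i t).2 p (some (i + (t : ZMod n)))) := by
  simp only [gnSweep] at h
  simp [gnRun, h]

theorem gap_of_dense {P : Finset (Prp n)} (hP : IsAdmissible n P) (i : ZMod n) {p : Prp n}
    (hp : p ∈ P) : loPos i p + 2 ≤ hiPos i p := by
  have hcard := hP.dense {p} (by simpa using hp) (by simp)
  obtain ⟨hle, hlt, he⟩ := loPos_hiPos_spec i p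
  simp only [suppSet, Finset.card_singleton, Finset.singleton_biUnion] at hcard
  by_contra hlt2
  have hs : supp n p ⊆ {i - 1 + (loPos i p : ZMod n), i + (loPos i p : ZMod n),
      i + (hiPos i p : ZMod n)} := by
    intro v hv
    rw [he, mem_supp_mk] at hv
    have e : ∀ c : ZMod n, i - 1 + c + 1 = i + c := fun c => by ring
    rw [e, e] at hv
    simp only [Finset.mem_insert, Finset.mem_singleton]
    rcases hv with h | h | h | h
    · exact Or.inl h
    · exact Or.inr (Or.inl h)
    · obtain h' | h' : hiPos i p = loPos i p ∨ hiPos i p = loPos i p + 1 := by omega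
      · rw [h'] at h; exact Or.inl h
      · right; left
        rw [h, h']; push_cast; ring
    · exact Or.inr (Or.inr h)
  have := (Finset.card_le_card hs).trans Finset.card_le_three
  omega

theorem gnSweep_valid {P : Finset (Prp n)} (hP : IsAdmissible n P) (i : ZMod n) :
    (gnSweep P i).Valid := by
  have hsub : ∀ u, (gnSweep P i).R u ⊆ P := by
    intro u
    induction u with
    | zero => exact Finset.Subset.refl _
    | succ u ih =>
      cases hq : (gnSweep P i).pk u with
      | none => simpa only [gnSweep, gnRun_succ_none hq] using ih
      | some q =>
        refine Finset.Subset.trans ?_ ih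
        simp only [gnSweep, gnRun_succ_some hq]
        exact Finset.erase_subset _ _
  have hgap : ∀ p ∈ P, loPos i p + 2 ≤ hiPos i p := fun p => gap_of_dense hP i
  refine ⟨hgap, fun p _ => (loPos_hiPos_spec i p).2.1, ?_, ?_, rfl, ?_, ?_, ?_, ?_, ?_, ?_⟩
  · intro p _ q _ h1 h2
    change loPos i p = loPos i q at h1
    change hiPos i p = hiPos i q at h2
    rw [(loPos_hiPos_spec i p).2.2, (loPos_hiPos_spec i q).2.2, h1, h2]
  · rintro p hp q hq ⟨h1, h2, h3⟩
    change loPos i p < loPos i q at h1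
    change loPos i q < hiPos i p at h2
    change hiPos i p < hiPos i q at h3
    obtain ⟨-, hpn, hpe⟩ := loPos_hiPos_spec i p
    obtain ⟨-, hqn, hqe⟩ := loPos_hiPos_spec i q
    refine hP.noncross p hp q hq ⟨_, _, _, _, hpe, hqe, ?_⟩
    rw [ord_add_add _ (by omega) (by omega), ord_add_add _ (by omega) (by omega),
      ord_add_add _ (by omega) (by omega), if_pos (by omega), if_pos (by omega), if_pos (by omega)]
    omega
  · intro u h
    simp only [gnSweep, gnRun_succ_none h]
  · intro u hu h p hp hs
    exact pickCW_eq_none h p hp ((sup_iff (hgap p (hsub u hp)) hu).1 hs)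
  · intro u p h
    exact (pickCW_eq_some h).1.1
  · intro u hu p h
    have := (pickCW_eq_some h).1
    exact (sup_iff (hgap p (hsub u this.1)) hu).2 this.2
  · intro u p h
    simp only [gnSweep, gnRun_succ_some h]
    congr!
  · intro u hu p h q hq hs
    have h1 := pickCW_eq_some h
    have hp := hgap p (hsub u h1.1.1)
    rw [key_eq (hgap q (hsub u hq)) hu hs, key_eq hp hu ((sup_iff hp hu).2 h1.1.2)]
    exact h1.2 q hq ((sup_iff (hgap q (hsub u hq)) hu).1 hs)

end Positions

section GreedyRank

variable {n : ℕ} [NeZero n] {P : Finset (Prp n)}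

theorem gnRun_snd_eq_some (hP : IsAdmissible n P) (i : ZMod n) (t : ℕ) (p : Prp n) (v : ZMod n) :
    (gnRun n P i t).2 p = some v ↔
      ∃ s < t, (gnSweep P i).pk s = some p ∧ v = i + (s : ZMod n) := by
  have hV := gnSweep_valid hP i
  induction t with
  | zero => simp [gnRun]
  | succ t ih =>
    cases hq : (gnSweep P i).pk t with
    | none =>
      rw [gnRun_succ_none hq]
      refine ih.trans ?_
      constructor
      · rintro ⟨s, hs, h⟩
        exact ⟨s, by omega, h⟩
      · rintro ⟨s, hs, h1, h2⟩
        refine ⟨s, ?_, h1, h2⟩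
        rcases Nat.lt_succ_iff_lt_or_eq.1 hs with h | rfl
        · exact h
        · rw [hq] at h1; cases h1
    | some q =>
      rw [gnRun_succ_some hq]
      by_cases hpq : p = q
      · subst hpq
        simp only [Function.update_self, Option.some.injEq]
        constructor
        · rintro rfl
          exact ⟨t, by omega, hq, rfl⟩
        · rintro ⟨s, hs, h1, h2⟩
          rw [h2, hV.pk_inj h1 hq]
      · simp only [Function.update_of_ne hpq, ih]
        constructor
        · rintro ⟨s, hs, h⟩
          exact ⟨s, by omega, h⟩
        · rintro ⟨s, hs, h1, h2⟩
          refine ⟨s, ?_, h1, h2⟩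
          rcases Nat.lt_succ_iff_lt_or_eq.1 hs with h | rfl
          · exact h
          · rw [hq] at h1; exact absurd (Option.some.inj h1).symm hpq

theorem mem_gnSet_iff (hP : IsAdmissible n P) (i : ZMod n) {t : ℕ} (ht : t < n) :
    i + (t : ZMod n) ∈ gnSet n P i ↔ ((gnSweep P i).pk t).isSome := by
  simp only [gnSet, gnAssign, Finset.mem_filter, Finset.mem_univ, true_and,
    gnRun_snd_eq_some hP, Option.isSome_iff_exists]
  refine exists_congr fun p => ⟨?_, fun h => ⟨t, ht, h, rfl⟩⟩
  rintro ⟨s, hs, h1, h2⟩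
  rwa [(pos_eq_iff ht hs).1 h2]

theorem card_picked (hP : IsAdmissible n P) (i : ZMod n) {T : ℕ} (hT : T ≤ n) :
    ((Finset.range T).filter fun u => ((gnSweep P i).pk u).isSome).card = irank P i T := by
  have hV := gnSweep_valid hP i
  have hgap : ∀ p ∈ P, loPos i p + 2 ≤ hiPos i p := fun p => gap_of_dense hP i
  set K := (Finset.range T).filter fun u => ((gnSweep P i).pk u).isSome with hK
  have hKT : ∀ u ∈ K, u < T := fun u hu => Finset.mem_range.1 (Finset.mem_filter.1 hu).1
  have hinj : ∀ u < T, ∀ v < T, i + (u : ZMod n) = i + (v : ZMod n) → u = v :=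
    fun u hu v hv h => (pos_eq_iff (hu.trans_le hT) (hv.trans_le hT)).1 h
  refine le_antisymm ?_ ?_
  · obtain ⟨U, hU, hr⟩ := exists_vrank_eq P (cint i T)
    rw [irank, hr, ← Finset.card_filter_add_card_filter_not (s := K)
      (fun u : ℕ => i + (u : ZMod n) ∈ U)]
    refine add_le_add ?_ ?_
    · have hsome : ∀ u ∈ K, ∃ p, (gnSweep P i).pk u = some p := fun u hu =>
        Option.isSome_iff_exists.1 (Finset.mem_filter.1 hu).2
      choose! f hf using hsome
      refine Finset.card_le_card_of_injOn f (fun u hu => ?_) (fun u hu v hv huv => ?_)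
      · obtain ⟨hu, huU⟩ := Finset.mem_filter.1 hu
        have hpk := hf u hu
        have hu' := (hKT u hu).trans_le hT
        have hmem := hV.R_subset _ (hV.some_mem _ _ hpk)
        exact mem_propsOn.2 ⟨hmem, _, huU,
          (sup_iff (hgap _ hmem) hu').1 (hV.some_sup u hu' _ hpk)⟩
      · have h1 := hf u (Finset.mem_filter.1 hu).1
        have h2 := hf v (Finset.mem_filter.1 hv).1
        rw [huv] at h1
        exact hV.pk_inj h1 h2
    · refine Finset.card_le_card_of_injOn (fun u : ℕ => i + (u : ZMod n)) (fun u hu => ?_)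
        (fun u hu v hv huv => ?_)
      · obtain ⟨hu, huU⟩ := Finset.mem_filter.1 hu
        exact Finset.mem_sdiff.2 ⟨mem_cint.2 ⟨u, hKT u hu, rfl⟩, huU⟩
      · exact hinj u (hKT u (Finset.mem_filter.1 hu).1) v (hKT v (Finset.mem_filter.1 hv).1) huv
  · obtain ⟨X, hX, hnone, hsome⟩ := hV.exists_tight T hT
    have hXT : ∀ u ∈ X, u < T := fun u hu => Finset.mem_range.1 (hX hu)
    have hU : X.image (fun u : ℕ => i + (u : ZMod n)) ⊆ cint i T := Finset.image_subset_image hX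
    refine (vrank_le hU).trans ?_
    rw [← Finset.card_filter_add_card_filter_not (s := K) (fun u : ℕ => u ∈ X)]
    refine add_le_add ?_ ?_
    · have hex : ∀ p ∈ propsOn n P (X.image fun u : ℕ => i + (u : ZMod n)),
          ∃ u ∈ X, (gnSweep P i).pk u = some p := by
        intro p hp
        obtain ⟨hp, y, hy, hs⟩ := mem_propsOn.1 hp
        obtain ⟨x, hx, rfl⟩ := Finset.mem_image.1 hy
        exact hsome x hx p hp ((sup_iff (hgap p hp) ((hXT x hx).trans_le hT)).2 hs)
      choose! f hf using hex
      refine Finset.card_le_card_of_injOn f (fun p hp => ?_) (fun p hp q hq hpq => ?_)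
      · obtain ⟨h1, h2⟩ := hf p hp
        exact Finset.mem_filter.2 ⟨Finset.mem_filter.2 ⟨hX h1, by rw [h2]; rfl⟩, h1⟩
      · have h1 := (hf p hp).2
        have h2 := (hf q hq).2
        rw [hpq] at h1
        exact Option.some.inj (h1.symm.trans h2)
    · refine (Finset.card_le_card (t := (K.filter fun u => u ∉ X).image
        fun u : ℕ => i + (u : ZMod n)) fun y hy => ?_).trans Finset.card_image_le
      obtain ⟨hy, hyX⟩ := Finset.mem_sdiff.1 hy
      obtain ⟨u, hu, rfl⟩ := mem_cint.1 hy
      have huX : u ∉ X := fun h => hyX (Finset.mem_image_of_mem _ h)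
      refine Finset.mem_image_of_mem _ (Finset.mem_filter.2 ⟨Finset.mem_filter.2
        ⟨Finset.mem_range.2 hu, ?_⟩, huX⟩)
      by_contra hn
      exact huX (hnone u hu (by simpa using hn))

/-- The necklace term at `i` is the greedy (lexicographically minimal) basis from `i`. -/
theorem mem_gnSet_iff_irank (hP : IsAdmissible n P) (i : ZMod n) {t : ℕ} (ht : t < n) :
    i + (t : ZMod n) ∈ gnSet n P i ↔ irank P i (t + 1) = irank P i t + 1 := by
  rw [mem_gnSet_iff hP i ht, ← card_picked hP i ht, ← card_picked hP i ht.le,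
    Finset.range_add_one, Finset.filter_insert]
  split_ifs with h
  · simp [h]
  · simp [h]

end GreedyRank

section Corners

variable {n : ℕ} [NeZero n] {k : ℕ} {r : ZMod n → ℕ → ℕ} (hr : IsIntervalRank k r)
include hr

namespace IsIntervalRank

theorem succ_eq_of_le {i : ZMod n} {t u : ℕ} (h : r i (t + 1) = r (i + 1) t) (htu : t ≤ u) :
    r i (u + 1) = r (i + 1) u := by
  induction u, htu using Nat.le_induction with
  | base => exact h
  | succ u _ ih =>
    have := hr.submod i u
    have : r (i + 1) (u + 1) ≤ r i (u + 2) := hr.mono_left i (u + 1)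
    change r i (u + 2) = _
    omega

theorem exists_corner {i : ZMod n} (h1 : r i 1 = 1) : ∃ t, 1 ≤ t ∧ t ≤ n ∧
    (∀ u < t, r i (u + 1) = r (i + 1) u + 1) ∧ ∀ u, t ≤ u → r i (u + 1) = r (i + 1) u := by
  have hex : ∃ t, r i (t + 1) = r (i + 1) t :=
    ⟨n, by rw [hr.full _ _ (Nat.le_succ n), hr.full _ _ le_rfl]⟩
  refine ⟨Nat.find hex, ?_, ?_, fun u hu => ?_, fun u hu => hr.succ_eq_of_le (Nat.find_spec hex) hu⟩
  · rw [Nat.one_le_iff_ne_zero]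
    intro h0
    have := Nat.find_spec hex
    rw [h0, zero_add, h1, hr.zero] at this
    omega
  · exact Nat.find_min' hex (by rw [hr.full _ _ (Nat.le_succ n), hr.full _ _ le_rfl])
  · have := Nat.find_min hex hu
    have := hr.left_le i u
    have := hr.mono_left i u
    omega

omit [NeZero n] hr in
theorem corner_iff_eq {i : ZMod n} {t t' : ℕ} (ht : 1 ≤ t)
    (hlt : ∀ u < t, r i (u + 1) = r (i + 1) u + 1)
    (hge : ∀ u, t ≤ u → r i (u + 1) = r (i + 1) u) (ht' : 1 ≤ t') : Corner r i t' ↔ t' = t := by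
  obtain ⟨t', rfl⟩ := Nat.exists_eq_add_of_le' ht'
  constructor
  · rintro ⟨h1, h2⟩
    rcases lt_trichotomy (t' + 1) t with h | h | h
    · have := hlt _ h; omega
    · exact h
    · have := hge t' (by omega)
      simp only [Nat.add_sub_cancel] at h1
      omega
  · rintro rfl
    exact ⟨hlt t' (by omega), hge _ le_rfl⟩

theorem not_corner {i : ZMod n} (h1 : r i 1 ≠ 1) {t : ℕ} (ht : 1 ≤ t) : ¬ Corner r i t := by
  rintro ⟨h2, -⟩
  obtain ⟨t, rfl⟩ := Nat.exists_eq_add_of_le' ht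
  have h0 : r i (0 + 1) = r (i + 1) 0 := by
    have := hr.right_le i 0
    rw [hr.zero] at *
    simp only [zero_add] at *
    omega
  have := hr.succ_eq_of_le h0 (Nat.zero_le t)
  simp only [Nat.add_sub_cancel] at h2
  omega

end IsIntervalRank

variable {I : ZMod n → Finset (ZMod n)}
  (hI : ∀ i, ∀ t < n, i + (t : ZMod n) ∈ I i ↔ r i (t + 1) = r i t + 1)
include hI

theorem self_mem_iff (i : ZMod n) : i ∈ I i ↔ r i 1 = 1 := by
  have := hI i 0 (Nat.pos_of_neZero n)
  rwa [Nat.cast_zero, add_zero, hr.zero, zero_add] at this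

theorem greedy_stay {i : ZMod n} (hi : i ∉ I i) : I (i + 1) = I i := by
  rw [self_mem_iff hr hI] at hi
  have h0 : r i (0 + 1) = r (i + 1) 0 := by
    have := hr.right_le i 0
    rw [hr.zero] at *
    simp only [zero_add] at *
    omega
  have h := fun u => hr.succ_eq_of_le h0 (Nat.zero_le u)
  ext x
  obtain ⟨u, hu, rfl⟩ := mem_cint.1 (by rw [cint_eq_univ (i + 1) le_rfl]; exact Finset.mem_univ x)
  rw [hI _ u hu]
  rcases Nat.lt_or_ge (u + 1) n with h1 | h1
  · have e : i + 1 + (u : ZMod n) = i + ((u + 1 : ℕ) : ZMod n) := by push_cast; ring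
    rw [e, hI _ _ h1, h, h]
  · have hn : u + 1 = n := by omega
    have e : i + 1 + (u : ZMod n) = i := by
      have : ((u + 1 : ℕ) : ZMod n) = 0 := by rw [hn]; simp
      push_cast at this
      linear_combination this
    rw [e, self_mem_iff hr hI, ← h u, hr.full (i + 1) (u + 1) hn.ge, hr.full i (u + 1) hn.ge]
    simp [hi]

theorem greedy_step {i : ZMod n} {t : ℕ} (ht : 1 ≤ t) (htn : t ≤ n)
    (hlt : ∀ u < t, r i (u + 1) = r (i + 1) u + 1)
    (hge : ∀ u, t ≤ u → r i (u + 1) = r (i + 1) u) :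
    i + (t : ZMod n) ∉ (I i).erase i ∧ I (i + 1) = insert (i + (t : ZMod n)) ((I i).erase i) := by
  have hn0 := Nat.pos_of_neZero n
  obtain ⟨v, rfl⟩ := Nat.exists_eq_add_of_le' ht
  have h1 := hlt v (by omega)
  have h2 := hge (v + 1) le_rfl
  have h3 := hr.right_le (i + 1) v
  have h4 := hr.mono_right i (v + 1)
  have hne : ∀ u : ℕ, u + 1 < n → i + ((u + 1 : ℕ) : ZMod n) ≠ i := fun u hu h => by
    have := (pos_eq_iff (i := i) hu hn0).1 (by simpa using h)
    omega
  have hlast : ∀ u : ℕ, u + 1 = n → i + ((u + 1 : ℕ) : ZMod n) = i := fun u hu => by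
    rw [hu]; simp
  constructor
  · rw [Finset.mem_erase]
    rintro ⟨hne', hm⟩
    rcases Nat.lt_or_ge (v + 1) n with hv | hv
    · rw [hI _ _ hv] at hm
      omega
    · exact hne' (hlast v (by omega))
  · ext x
    obtain ⟨u, hu, rfl⟩ := mem_cint.1 (by rw [cint_eq_univ (i + 1) le_rfl]; exact Finset.mem_univ x)
    have e : i + 1 + (u : ZMod n) = i + ((u + 1 : ℕ) : ZMod n) := by push_cast; ring
    rw [hI _ u hu, Finset.mem_insert, Finset.mem_erase]
    have ev : i + 1 + (u : ZMod n) = i + ((v + 1 : ℕ) : ZMod n) ↔ u = v := by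
      have e' : i + ((v + 1 : ℕ) : ZMod n) = i + 1 + (v : ZMod n) := by push_cast; ring
      rw [e', pos_eq_iff hu (by omega)]
    rw [ev]
    rcases lt_trichotomy u v with huv | rfl | huv
    · have hu' : u + 1 < n := by omega
      rw [e, hI _ _ hu', hlt u (by omega), hlt (u + 1) (by omega)]
      have := hne u hu'
      constructor
      · intro h; exact Or.inr ⟨this, by omega⟩
      · rintro (h | ⟨-, h⟩) <;> omega
    · simp only [true_or, iff_true]
      omega
    · rcases Nat.lt_or_ge (u + 1) n with hu' | hu'
      · rw [e, hI _ _ hu', hge u (by omega), hge (u + 1) (by omega)]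
        have := hne u hu'
        constructor
        · intro h; exact Or.inr ⟨this, by omega⟩
        · rintro (h | ⟨-, h⟩) <;> omega
      · rw [e, hlast u (by omega)]
        have h5 := hge u (by omega)
        rw [hr.full i (u + 1) hu'] at h5
        rw [hr.full (i + 1) (u + 1) hu']
        constructor
        · intro h; omega
        · rintro (h | ⟨h, -⟩)
          · omega
          · exact absurd rfl h

theorem card_greedy (i : ZMod n) {T : ℕ} (hT : T ≤ n) :
    ((Finset.range T).filter fun u : ℕ => i + (u : ZMod n) ∈ I i).card = r i T := by
  induction T with
  | zero => simp [hr.zero]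
  | succ T ih =>
    have ih := ih (by omega)
    rw [Finset.range_add_one, Finset.filter_insert]
    have h1 := hr.right_le i T
    have h2 := hr.mono_right i T
    have h3 := hI i T hT
    split_ifs with h
    · rw [Finset.card_insert_of_notMem (by simp), ih]
      exact (h3.1 h).symm
    · rw [ih]
      have := mt h3.2 h
      omega

end Corners

section Linearize

variable {n : ℕ}

/-- The positions of the elements of `X` in the order `<₁`. -/
noncomputable def lin (X : Finset (ZMod n)) : Finset ℕ :=
  (Finset.range n).filter fun x : ℕ => 1 + (x : ZMod n) ∈ X

theorem mem_lin {X : Finset (ZMod n)} {x : ℕ} : x ∈ lin X ↔ x < n ∧ 1 + (x : ZMod n) ∈ X := by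
  simp [lin]

variable [NeZero n]

theorem exists_pos (v : ZMod n) : ∃ x < n, 1 + (x : ZMod n) = v :=
  ⟨ord n 1 v, ZMod.val_lt _, add_ord 1 v⟩

omit [NeZero n] in
theorem ord_one {x : ℕ} (hx : x < n) : ord n 1 (1 + (x : ZMod n)) = x := by
  simp [ord, ZMod.val_natCast_of_lt hx]

theorem card_filter_lin (X Y : Finset (ZMod n)) (f : ℕ → Prop) [DecidablePred f] :
    ((lin X \ lin Y).filter f).card = ((X \ Y).filter fun v => f (ord n 1 v)).card := by
  refine Finset.card_bij (fun x _ => 1 + (x : ZMod n)) ?_ ?_ ?_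
  · intro x hx
    simp only [Finset.mem_filter, Finset.mem_sdiff, mem_lin] at hx ⊢
    obtain ⟨⟨⟨h1, h2⟩, h3⟩, h4⟩ := hx
    exact ⟨⟨h2, fun h => h3 ⟨h1, h⟩⟩, by rwa [ord_one h1]⟩
  · intro x hx y hy hxy
    simp only [Finset.mem_filter, Finset.mem_sdiff, mem_lin] at hx hy
    exact (pos_eq_iff hx.1.1.1 hy.1.1.1).1 hxy
  · intro v hv
    obtain ⟨x, hx, rfl⟩ := exists_pos v
    simp only [Finset.mem_filter, Finset.mem_sdiff, ord_one hx] at hv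
    refine ⟨x, ?_, rfl⟩
    simp only [Finset.mem_filter, Finset.mem_sdiff, mem_lin]
    exact ⟨⟨⟨hx, hv.1.1⟩, fun h => hv.1.2 h.2⟩, hv.2⟩

theorem plus_lin_iff {X Y : Finset (ZMod n)} {a b : ℕ} (ha : a < n) (hb : b < n) :
    Plus (lin X) (lin Y) a b ↔ LePlusAt n X Y (1 + (a : ZMod n)) (1 + (b : ZMod n)) := by
  unfold Plus LePlusAt
  rw [card_filter_lin, card_filter_lin, ord_one ha, ord_one hb]
  simp only [Finset.mem_sdiff, mem_lin, ha, hb, true_and]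

theorem plusCount_eq_card_plusses (P : Finset (Prp n)) :
    plusCount n P = (plusses n (fun s => lin (gnSet n P (1 + (s : ZMod n)))) n).card := by
  symm
  refine Finset.card_bij (fun ab _ => (1 + (ab.1 : ZMod n), 1 + (ab.2 : ZMod n))) ?_ ?_ ?_
  · rintro ⟨a, b⟩ hab
    simp only [plusses, Finset.mem_filter, Finset.mem_product, Finset.mem_range] at hab
    obtain ⟨⟨ha, hb⟩, s, -, hs⟩ := hab
    rw [plus_lin_iff ha hb] at hs
    refine Finset.mem_filter.2 ⟨Finset.mem_univ _, 1 + (s : ZMod n), ?_⟩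
    simpa using hs
  · rintro ⟨a, b⟩ hab ⟨a', b'⟩ hab' h
    simp only [plusses, Finset.mem_filter, Finset.mem_product, Finset.mem_range] at hab hab'
    obtain ⟨h1, h2⟩ := Prod.mk.inj h
    rw [(pos_eq_iff hab.1.1 hab'.1.1).1 h1, (pos_eq_iff hab.1.2 hab'.1.2).1 h2]
  · rintro ⟨v, w⟩ hvw
    obtain ⟨i, hi⟩ := (Finset.mem_filter.1 hvw).2
    obtain ⟨a, ha, rfl⟩ := exists_pos v
    obtain ⟨b, hb, rfl⟩ := exists_pos w
    obtain ⟨s, hs, rfl⟩ := exists_pos i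
    refine ⟨(a, b), ?_, rfl⟩
    simp only [plusses, Finset.mem_filter, Finset.mem_product, Finset.mem_range]
    refine ⟨⟨ha, hb⟩, s, by omega, (plus_lin_iff ha hb).2 ?_⟩
    simpa using hi

variable {k : ℕ} {r : ZMod n → ℕ → ℕ} (hr : IsIntervalRank k r) {I : ZMod n → Finset (ZMod n)}
  (hI : ∀ i, ∀ t < n, i + (t : ZMod n) ∈ I i ↔ r i (t + 1) = r i t + 1)
include hr hI

theorem card_lin_zero : (lin (I (1 + ((0 : ℕ) : ZMod n)))).card = k := by
  have := card_greedy hr hI 1 le_rfl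
  rw [hr.full _ _ le_rfl] at this
  simpa [lin] using this

theorem exists_linNecklace : ∃ j : ℕ → ℕ,
    LinNecklace n (fun s => lin (I (1 + (s : ZMod n)))) j ∧
    ∀ s < n, 1 + (s : ZMod n) ∈ I (1 + (s : ZMod n)) → ∃ t, 1 ≤ t ∧ t ≤ n ∧ j s = (s + t) % n ∧
      ∀ t', 1 ≤ t' → (Corner r (1 + (s : ZMod n)) t' ↔ t' = t) := by
  have hn0 := Nat.pos_of_neZero n
  have hex : ∀ s : ℕ, ∃ t, 1 + (s : ZMod n) ∈ I (1 + (s : ZMod n)) → 1 ≤ t ∧ t ≤ n ∧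
      (∀ u < t, r (1 + (s : ZMod n)) (u + 1) = r (1 + (s : ZMod n) + 1) u + 1) ∧
      ∀ u, t ≤ u → r (1 + (s : ZMod n)) (u + 1) = r (1 + (s : ZMod n) + 1) u := by
    intro s
    by_cases hs : 1 + (s : ZMod n) ∈ I (1 + (s : ZMod n))
    · obtain ⟨t, ht⟩ := hr.exists_corner ((self_mem_iff hr hI _).1 hs)
      exact ⟨t, fun _ => ht⟩
    · exact ⟨0, fun h => absurd h hs⟩
  choose t ht using hex
  have hmem : ∀ s < n, s ∈ lin (I (1 + (s : ZMod n))) ↔ 1 + (s : ZMod n) ∈ I (1 + (s : ZMod n)) :=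
    fun s hs => by rw [mem_lin]; exact and_iff_right hs
  have hcast : ∀ s : ℕ, 1 + ((s + 1 : ℕ) : ZMod n) = 1 + (s : ZMod n) + 1 := fun s => by
    push_cast; ring
  have hmod : ∀ s : ℕ, 1 + (((s + t s) % n : ℕ) : ZMod n) = 1 + (s : ZMod n) + (t s : ZMod n) :=
    fun s => by rw [ZMod.natCast_mod]; push_cast; ring
  have hlt : ∀ s : ℕ, (s + t s) % n < n := fun s => Nat.mod_lt _ hn0
  refine ⟨fun s => (s + t s) % n, ⟨fun s => Finset.filter_subset _ _, ?_, ?_, ?_, ?_⟩, ?_⟩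
  · simp
  · intro s hs hm
    rw [hmem s hs] at hm
    simp only [hcast, greedy_stay hr hI hm]
  · intro s hs hm
    rw [hmem s hs] at hm
    obtain ⟨h1, h2, h3, h4⟩ := ht s hm
    have h := (greedy_step hr hI h1 h2 h3 h4).1
    rw [← hmod] at h
    rw [Finset.mem_erase, mem_lin]
    rintro ⟨h5, h6, h7⟩
    exact h (Finset.mem_erase.2 ⟨fun h8 => h5 ((pos_eq_iff h6 hs).1 h8), h7⟩)
  · intro s hs hm
    rw [hmem s hs] at hm
    obtain ⟨h1, h2, h3, h4⟩ := ht s hm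
    have h := (greedy_step hr hI h1 h2 h3 h4).2
    rw [← hmod] at h
    ext x
    simp only [hcast, h, mem_lin, Finset.mem_insert, Finset.mem_erase]
    constructor
    · rintro ⟨hx, h5 | ⟨h5, h6⟩⟩
      · exact Or.inl ((pos_eq_iff hx (hlt s)).1 h5)
      · exact Or.inr ⟨fun h7 => h5 (by rw [h7]), hx, h6⟩
    · rintro (h5 | ⟨h5, hx, h6⟩)
      · exact ⟨h5 ▸ hlt s, Or.inl (by rw [h5])⟩
      · exact ⟨hx, Or.inr ⟨fun h7 => h5 ((pos_eq_iff hx hs).1 h7), h6⟩⟩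
  · intro s hs hm
    obtain ⟨h1, h2, h3, h4⟩ := ht s hm
    exact ⟨t s, h1, h2, rfl, fun t' ht' => IsIntervalRank.corner_iff_eq h1 h3 h4 ht'⟩

theorem cycCount_lin {j : ℕ → ℕ} {s t : ℕ} (hs : s < n) (ht : 1 ≤ t) (htn : t ≤ n)
    (hj : j s = (s + t) % n) (hm : 1 + (s : ZMod n) ∈ I (1 + (s : ZMod n))) :
    cycCount (fun s => lin (I (1 + (s : ZMod n)))) j s = r (1 + (s : ZMod n) + 1) t := by
  have hcast : 1 + ((s + 1 : ℕ) : ZMod n) = 1 + (s : ZMod n) + 1 := by push_cast; ring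
  have hms : s ∈ lin (I (1 + (s : ZMod n))) := mem_lin.2 ⟨hs, hm⟩
  have h1 := card_greedy hr hI (1 + (s : ZMod n) + 1) htn
  have h2 := card_greedy hr hI (1 + (s : ZMod n) + 1) le_rfl
  rw [hr.full _ _ le_rfl] at h2
  unfold cycCount
  simp only [hms, if_true, card_lin_zero hr hI, hcast]
  set X := I (1 + (s : ZMod n) + 1)
  rcases Nat.lt_or_ge (s + t) n with hw | hw
  · rw [Nat.mod_eq_of_lt hw] at hj
    rw [hj, if_neg (by omega), ← h1]
    symm
    refine Finset.card_bij (fun u _ => s + 1 + u) ?_ (fun _ _ _ _ h => by omega) ?_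
    · intro u hu
      simp only [Finset.mem_filter, Finset.mem_range, mem_lin] at hu ⊢
      refine ⟨⟨by omega, ?_⟩, by omega, by omega⟩
      have e : 1 + ((s + 1 + u : ℕ) : ZMod n) = 1 + (s : ZMod n) + 1 + u := by push_cast; ring
      rw [e]
      exact hu.2
    · intro x hx
      simp only [Finset.mem_filter, mem_lin] at hx
      obtain ⟨u, rfl⟩ := Nat.exists_eq_add_of_le hx.2.1
      refine ⟨u, Finset.mem_filter.2 ⟨Finset.mem_range.2 (by omega), ?_⟩, rfl⟩
      have e : 1 + ((s + 1 + u : ℕ) : ZMod n) = 1 + (s : ZMod n) + 1 + u := by push_cast; ring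
      rw [← e]
      exact hx.1.2
  · have hj' : j s = s + t - n := by
      rw [hj, Nat.mod_eq_sub_mod hw, Nat.mod_eq_of_lt (by omega)]
    rw [hj', if_pos (by omega)]
    have e : ∀ u : ℕ, n ≤ s + 1 + u →
        1 + ((s + 1 + u - n : ℕ) : ZMod n) = 1 + (s : ZMod n) + 1 + u := fun u hu => by
      rw [Nat.cast_sub hu]; push_cast; simp; ring
    have h3 : cnt (lin X) (s + t - n) s = ((Finset.range n).filter fun u : ℕ =>
        1 + (s : ZMod n) + 1 + (u : ZMod n) ∈ X ∧ t ≤ u).card := by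
      symm
      refine Finset.card_bij (fun u _ => s + 1 + u - n) ?_ (fun u hu v hv h => ?_) ?_
      · intro u hu
        simp only [Finset.mem_filter, Finset.mem_range, mem_lin] at hu ⊢
        refine ⟨⟨by omega, ?_⟩, by omega, by omega⟩
        rw [e u (by omega)]
        exact hu.2.1
      · simp only [Finset.mem_filter, Finset.mem_range] at hu hv
        omega
      · intro x hx
        simp only [Finset.mem_filter, mem_lin] at hx
        refine ⟨x + n - (s + 1), ?_, by omega⟩
        simp only [Finset.mem_filter, Finset.mem_range]
        refine ⟨by omega, ?_, by omega⟩
        rw [← e _ (by omega)]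
        have : s + 1 + (x + n - (s + 1)) - n = x := by omega
        rw [this]
        exact hx.1.2
    have h4 : ((Finset.range n).filter fun u : ℕ =>
        1 + (s : ZMod n) + 1 + (u : ZMod n) ∈ X ∧ t ≤ u).card + r (1 + (s : ZMod n) + 1) t = k := by
      have h5 := Finset.card_filter_add_card_filter_not
        (s := (Finset.range n).filter fun u : ℕ => 1 + (s : ZMod n) + 1 + (u : ZMod n) ∈ X)
        (fun u => t ≤ u)
      rw [Finset.filter_filter, Finset.filter_filter, h2] at h5
      rw [← h5, ← h1]
      congr 2
      ext u
      simp only [Finset.mem_filter, Finset.mem_range]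
      constructor
      · rintro ⟨h6, h7⟩
        exact ⟨by omega, h7, by omega⟩
      · rintro ⟨h6, h7, h8⟩
        exact ⟨by omega, h7⟩
    rw [h3]
    omega

theorem sum_cycCount_lin {j : ℕ → ℕ}
    (hj : ∀ s < n, 1 + (s : ZMod n) ∈ I (1 + (s : ZMod n)) → ∃ t, 1 ≤ t ∧ t ≤ n ∧
      j s = (s + t) % n ∧ ∀ t', 1 ≤ t' → (Corner r (1 + (s : ZMod n)) t' ↔ t' = t)) :
    ∑ s ∈ Finset.range n, cycCount (fun s => lin (I (1 + (s : ZMod n)))) j s = cornerSum r := by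
  rw [cornerSum, Finset.sum_comm]
  refine Finset.sum_bij (fun s _ => 1 + (s : ZMod n)) (fun _ _ => Finset.mem_univ _)
    (fun s hs s' hs' h => ?_) (fun v _ => ?_) (fun s hs => ?_)
  · exact (pos_eq_iff (Finset.mem_range.1 hs) (Finset.mem_range.1 hs')).1 h
  · obtain ⟨x, hx, h⟩ := exists_pos v
    exact ⟨x, Finset.mem_range.2 hx, h⟩
  · have hs := Finset.mem_range.1 hs
    by_cases hm : 1 + (s : ZMod n) ∈ I (1 + (s : ZMod n))
    · obtain ⟨t, ht, htn, hjt, hc⟩ := hj s hs hm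
      rw [cycCount_lin hr hI hs ht htn hjt hm,
        Finset.sum_eq_single_of_mem t (Finset.mem_Icc.2 ⟨ht, htn⟩), if_pos ((hc t ht).2 rfl)]
      intro t' ht' hne
      rw [if_neg fun h => hne ((hc t' (Finset.mem_Icc.1 ht').1).1 h)]
    · have hms : s ∉ lin (I (1 + (s : ZMod n))) := fun h => hm (mem_lin.1 h).2
      rw [cycCount, if_neg hms]
      refine (Finset.sum_eq_zero fun t ht => if_neg ?_).symm
      exact hr.not_corner (fun h => hm ((self_mem_iff hr hI _).2 h)) (Finset.mem_Icc.1 ht).1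

omit hr hI in
theorem plusCount_add_sq {P : Finset (Prp n)} (hP : IsAdmissible n P) :
    plusCount n P + vrank P Finset.univ * vrank P Finset.univ = cornerSum (irank P) := by
  have hr := isIntervalRank_irank P
  have hI := fun i t (ht : t < n) => mem_gnSet_iff_irank hP i ht
  obtain ⟨j, hL, hj⟩ := exists_linNecklace hr hI
  have h := hL.card_plusses_add_sq
  rw [sum_cycCount_lin hr hI hj, ← plusCount_eq_card_plusses, card_lin_zero hr hI] at h
  exact h

end Linearize

/-- dihedral invariance of the number of plusses.
If two admissible Wilson loop diagrams differ by a dihedral transformation (a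
rotation or a reflection of the cyclic vertex set applied simultaneously to all
propagators; on edge labels a rotation is `e ↦ e + c` and a reflection is
`e ↦ c - 1 - e`), then their Le diagrams contain the same number of `+`
entries. -/
theorem plusCount_dihedral_invariant
    (n : ℕ) [NeZero n] (P Q : Finset (Prp n))
    (hP : IsAdmissible n P) (hQ : IsAdmissible n Q)
    (hdihedral : (∃ c : ZMod n, Q = P.image (Sym2.map fun e => e + c)) ∨
      (∃ c : ZMod n, Q = P.image (Sym2.map fun e => c - 1 - e))) :
    plusCount n P = plusCount n Q := by
  obtain ⟨h1, h2⟩ := cornerSum_irank_dihedral hdihedral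
  have hp := plusCount_add_sq hP
  have hq := plusCount_add_sq hQ
  rw [h1, h2] at hp
  omega

end WLD
end

section
/- Let W be an admissible Wilson loop diagram with k ≥ 1 propagators. Then there is a dihedral transformation W' of W containing a propagator p = (i, n−1) for some i such that no propagator lies inside (p, <_i), and such that either the edge i of W' supports no propagator other than p, or the edge i of W' supports exactly one other propagator q = (j, i), which has no propagator inside (q, <_j). -/
open scoped Classical

namespace WLD

variable (n : ℕ)

/-- No propagator of `P` other than `(i,j)` itself has both ends on the arc from `i` to `j`. -/
def EmptyArc (P : Finset (Prp n)) (i j : ZMod n) : Prop :=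
  ∀ k l, s(k, l) ∈ P → ord n i k < ord n i l → ord n i l ≤ ord n i j →
    (s(k, l) : Prp n) = s(i, j)

theorem ord_self (a : ZMod n) : ord n a a = 0 := by simp [ord]

theorem ord_lt [NeZero n] (a x : ZMod n) : ord n a x < n := ZMod.val_lt _

theorem ord_injective [NeZero n] (a : ZMod n) : Function.Injective (ord n a) := fun x y h => by
  simpa using ZMod.val_injective n h

theorem ord_ne [NeZero n] (a : ZMod n) {x y : ZMod n} (h : x ≠ y) : ord n a x ≠ ord n a y :=
  (ord_injective n a).ne h

/-- Change of base point in the cyclic order. -/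
theorem ord_rebase [NeZero n] (a x y : ZMod n) :
    (ord n a x ≤ ord n a y ∧ ord n a x + ord n x y = ord n a y) ∨
      (ord n a y < ord n a x ∧ ord n a x + ord n x y = ord n a y + n) := by
  have h1 : ord n a y = (ord n a x + ord n x y) % n := by
    unfold ord
    rw [← ZMod.val_add]
    congr 1
    ring
  have hx := ord_lt n a x
  have hy := ord_lt n x y
  rcases Nat.lt_or_ge (ord n a x + ord n x y) n with h | h
  · rw [Nat.mod_eq_of_lt h] at h1
    omega
  · rw [Nat.mod_eq_sub_mod h, Nat.mod_eq_of_lt (by omega)] at h1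
    omega

theorem ord_add_right (c a x : ZMod n) : ord n (a + c) (x + c) = ord n a x := by
  simp [ord]

theorem ord_neg (a x : ZMod n) : ord n (-a) (-x) = ord n x a := by
  unfold ord
  congr 1
  ring

/-- Admissible diagrams have no propagator joining an edge to itself. -/
theorem IsAdmissible.ne_of_mem {n : ℕ} {P : Finset (Prp n)} (h : IsAdmissible n P)
    {x y : ZMod n} (hxy : s(x, y) ∈ P) : x ≠ y := by
  rintro rfl
  have h1 := h.dense {s(x, x)} (by simpa using hxy) (by simp)
  have h2 : suppSet n {s(x, x)} ⊆ {x, x + 1} := by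
    intro z hz
    simp [suppSet, supp] at hz ⊢
    tauto
  have h3 := Finset.card_le_card h2
  have h4 := Finset.card_le_two (a := x) (b := x + 1)
  simp only [Finset.card_singleton] at h1
  omega

/-- Non-crossing, read off in the linear order based at `a`. -/
theorem IsAdmissible.ord_le_of_mem {n : ℕ} {P : Finset (Prp n)} (h : IsAdmissible n P)
    {a b k x : ZMod n} (hab : s(a, b) ∈ P) (hkx : s(k, x) ∈ P)
    (h0 : 0 < ord n a k) (hk : ord n a k < ord n a b) : ord n a x ≤ ord n a b := by
  by_contra! hx
  exact h.noncross _ hab _ hkx ⟨a, b, k, x, rfl, rfl, h0, hk, hx⟩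

/-- Two empty arcs of `P` ending at the same edge coincide. -/
theorem EmptyArc.left_unique [NeZero n] {P : Finset (Prp n)} {i x y : ZMod n}
    (hx : EmptyArc n P x i) (hy : EmptyArc n P y i) (hxP : s(x, i) ∈ P) (hyP : s(y, i) ∈ P)
    (hxi : x ≠ i) (hyi : y ≠ i) : x = y := by
  by_contra hxy
  have h1 := ord_rebase n x y i
  have h2 := ord_rebase n y x i
  have h3 := ord_rebase n x y x
  have h4 := ord_lt n x y
  have h5 := ord_lt n x i
  have h6 := ord_self n x
  have h7 := ord_self n y
  have h8 := ord_ne n x hyi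
  have h9 := ord_ne n y hxi
  have h10 := ord_ne n x hxy
  by_cases h : ord n x y < ord n x i
  · have := hx y i hyP h le_rfl
    simp only [Sym2.congr_left] at this
    exact hxy this.symm
  · have := hy x i hxP (by omega) le_rfl
    simp only [Sym2.congr_left] at this
    exact hxy this

/-- Two empty arcs of `P` starting at the same edge coincide. -/
theorem EmptyArc.right_unique [NeZero n] {P : Finset (Prp n)} {i x y : ZMod n}
    (hx : EmptyArc n P i x) (hy : EmptyArc n P i y) (hxP : s(i, x) ∈ P) (hyP : s(i, y) ∈ P)
    (hxi : i ≠ x) (hyi : i ≠ y) : x = y := by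
  have h1 := ord_self n i
  have h2 := ord_ne n i hxi
  have h3 := ord_ne n i hyi
  rcases le_total (ord n i x) (ord n i y) with h | h
  · exact Sym2.congr_right.1 (hy i x hxP (by omega) h)
  · exact (Sym2.congr_right.1 (hx i y hyP (by omega) h)).symm

/-- `(i,m)` is a propagator of `P` with empty arc from `i` to `m`, and all other propagators
on the edge `i` have an empty arc ending at `i`. -/
def GoodForward (P : Finset (Prp n)) (i m : ZMod n) : Prop :=
  s(i, m) ∈ P ∧ EmptyArc n P i m ∧ ∀ x, s(i, x) ∈ P → x = m ∨ EmptyArc n P x i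

/-- The mirror image of `GoodForward`. -/
def GoodBackward (P : Finset (Prp n)) (i m : ZMod n) : Prop :=
  s(m, i) ∈ P ∧ EmptyArc n P m i ∧ ∀ x, s(x, i) ∈ P → x = m ∨ EmptyArc n P i x

theorem mem_image_map_equiv (e : ZMod n ≃ ZMod n) (P : Finset (Prp n)) (x y : ZMod n) :
    s(x, y) ∈ P.image (Sym2.map e) ↔ s(e.symm x, e.symm y) ∈ P := by
  rw [Finset.mem_image]
  constructor
  · rintro ⟨r, hr, h⟩
    induction r with
    | _ u v =>
      have : (s(u, v) : Prp n) = s(e.symm x, e.symm y) := by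
        apply Sym2.map.injective e.injective
        simpa using h
      rwa [← this]
  · intro h
    exact ⟨_, h, by simp⟩

theorem EmptyArc.image_add {P : Finset (Prp n)} {i j : ZMod n} (h : EmptyArc n P i j)
    (c : ZMod n) : EmptyArc n (P.image (Sym2.map fun e => e + c)) (i + c) (j + c) := by
  intro k l hkl h1 h2
  have hmem := (mem_image_map_equiv n (Equiv.addRight c) P k l).1 hkl
  rw [ord_add_right] at h2
  have e1 : ∀ x, ord n (i + c) x = ord n i (x - c) := fun x => by
    rw [← ord_add_right n c i, sub_add_cancel]
  rw [e1] at h2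
  rw [e1, e1] at h1
  have := congrArg (Sym2.map fun e => e + c) (h (k - c) (l - c)
    (by simpa [sub_eq_add_neg] using hmem) h1 h2)
  simpa using this

theorem EmptyArc.image_neg [NeZero n] {P : Finset (Prp n)} {i j : ZMod n} (h : EmptyArc n P i j) :
    EmptyArc n (P.image (Sym2.map fun e => -e)) (-j) (-i) := by
  intro k l hkl h1 h2
  have hmem : s(-k, -l) ∈ P := by
    simpa using (mem_image_map_equiv n (Equiv.neg _) P k l).1 hkl
  have e1 : ∀ x, ord n (-j) x = ord n (-x) j := fun x => by
    rw [← ord_neg, neg_neg]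
  rw [e1, e1, neg_neg] at h2
  rw [e1, e1] at h1
  have a1 := ord_rebase n i (-k) j
  have a2 := ord_rebase n i (-l) j
  have a3 := ord_lt n i (-k)
  have a4 := ord_lt n i (-l)
  have := congrArg (Sym2.map fun e => -e) (h (-l) (-k)
    (by rwa [Sym2.eq_swap]) (by omega) (by omega))
  rw [Sym2.eq_swap (a := k), Sym2.eq_swap (a := -j)]
  simpa using this

theorem GoodBackward.image_neg [NeZero n] {P : Finset (Prp n)} {i m : ZMod n}
    (h : GoodBackward n P i m) :
    GoodForward n (P.image (Sym2.map fun e => -e)) (-i) (-m) := by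
  have hmem : ∀ x y, s(x, y) ∈ P.image (Sym2.map fun e => -e) → s(-x, -y) ∈ P := fun x y hxy => by
    simpa using (mem_image_map_equiv n (Equiv.neg _) P x y).1 hxy
  refine ⟨Finset.mem_image.2 ⟨_, h.1, by simp [Sym2.eq_swap]⟩, h.2.1.image_neg n, fun x hx => ?_⟩
  have hx' := hmem _ _ hx
  rw [neg_neg, Sym2.eq_swap] at hx'
  rcases h.2.2 _ hx' with h1 | h1
  · exact Or.inl (by rw [← h1, neg_neg])
  · exact Or.inr (by simpa using h1.image_neg n)

theorem EmptyArc.eq_of_insideDir {P : Finset (Prp n)} {i j : ZMod n}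
    (h : EmptyArc n P i j) {r : Prp n} (hr : r ∈ P) (hin : InsideDir n i s(i, j) r) :
    r = s(i, j) := by
  obtain ⟨j', k, l, h1, rfl, h2, h3⟩ := hin
  rw [Sym2.congr_right] at h1
  subst h1
  exact h k l hr h2 h3

/-- A good propagator can be rotated so that its far end is the edge `n - 1`. -/
theorem GoodForward.exists_rotation [NeZero n] {P : Finset (Prp n)}
    (hP : ∀ x y, s(x, y) ∈ P → x ≠ y) {i₀ m : ZMod n} (h : GoodForward n P i₀ m) :
    ∃ c i : ZMod n,
      (s(i, -1) : Prp n) ∈ P.image (Sym2.map fun e => e + c) ∧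
      (∀ r ∈ P.image (Sym2.map fun e => e + c),
        InsideDir n i (s(i, -1) : Prp n) r → r = (s(i, -1) : Prp n)) ∧
      ((∀ r ∈ P.image (Sym2.map fun e => e + c), i ∈ r → r = (s(i, -1) : Prp n)) ∨
       (∃ j : ZMod n, (s(j, i) : Prp n) ∈ P.image (Sym2.map fun e => e + c) ∧
          (s(j, i) : Prp n) ≠ (s(i, -1) : Prp n) ∧
          (∀ r ∈ P.image (Sym2.map fun e => e + c), i ∈ r →
            r = (s(i, -1) : Prp n) ∨ r = (s(j, i) : Prp n)) ∧
          (∀ r ∈ P.image (Sym2.map fun e => e + c),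
            InsideDir n j (s(j, i) : Prp n) r → r = (s(j, i) : Prp n)))) := by
  obtain ⟨c, hc⟩ : ∃ c, m + c = -1 := ⟨-1 - m, by ring⟩
  obtain ⟨hmem, hempty, hother⟩ := h
  have hend : ∀ r ∈ P.image (Sym2.map fun e => e + c), i₀ + c ∈ r →
      ∃ x, s(i₀, x) ∈ P ∧ r = s(i₀ + c, x + c) := by
    intro r hr hir
    obtain ⟨y, rfl⟩ := hir
    have := (mem_image_map_equiv n (Equiv.addRight c) P _ _).1 hr
    exact ⟨y - c, by simpa [sub_eq_add_neg] using this, by simp⟩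
  refine ⟨c, i₀ + c, ?_⟩
  rw [← hc]
  refine ⟨Finset.mem_image.2 ⟨_, hmem, by simp⟩,
    fun r hr hin => (hempty.image_add n c).eq_of_insideDir n hr hin, ?_⟩
  by_cases hall : ∀ x, s(i₀, x) ∈ P → x = m
  · left
    intro r hr hir
    obtain ⟨x, hx, rfl⟩ := hend r hr hir
    rw [hall x hx]
  · right
    push Not at hall
    obtain ⟨j, hj, hjm⟩ := hall
    have hjE := (hother j hj).resolve_left hjm
    have hj' : s(j, i₀) ∈ P := by rwa [Sym2.eq_swap]
    refine ⟨j + c, Finset.mem_image.2 ⟨_, hj', by simp⟩, ?_, ?_,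
      fun r hr hin => (hjE.image_add n c).eq_of_insideDir n hr hin⟩
    · rw [Sym2.eq_swap, Ne, Sym2.congr_right]
      simpa using hjm
    · intro r hr hir
      obtain ⟨x, hx, rfl⟩ := hend r hr hir
      rcases hother x hx with rfl | hxE
      · exact Or.inl rfl
      · right
        have hx' : s(x, i₀) ∈ P := by rwa [Sym2.eq_swap]
        rw [hxE.left_unique n hjE hx' hj' (hP _ _ hx') (hP _ _ hj'), Sym2.eq_swap]

/-- An admissible diagram with at least one propagator has a good propagator, up to mirror
image: look inside a shortest nonempty arc. -/
theorem IsAdmissible.exists_good [NeZero n] {P : Finset (Prp n)} (hadm : IsAdmissible n P)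
    (hne : P.Nonempty) : ∃ i m, GoodForward n P i m ∨ GoodBackward n P i m := by
  by_cases hall : ∀ a b, s(a, b) ∈ P → EmptyArc n P a b
  · obtain ⟨p, hp⟩ := hne
    induction p using Sym2.ind with
    | _ i m =>
      exact ⟨i, m, Or.inl ⟨hp, hall _ _ hp,
        fun x hx => Or.inr (hall _ _ (by rwa [Sym2.eq_swap]))⟩⟩
  push Not at hall
  obtain ⟨a₀, b₀, h₀⟩ := hall
  obtain ⟨⟨a, b⟩, ⟨hab, hnE⟩, hmin⟩ := exists_minimalFor_of_wellFoundedLT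
    (fun ab : ZMod n × ZMod n => s(ab.1, ab.2) ∈ P ∧ ¬ EmptyArc n P ab.1 ab.2)
    (fun ab => ord n ab.1 ab.2) ⟨(a₀, b₀), h₀⟩
  have hshort : ∀ u v, s(u, v) ∈ P → ord n u v < ord n a b → EmptyArc n P u v := by
    intro u v huv hlt
    by_contra hE
    have := hmin (j := (u, v)) ⟨huv, hE⟩ hlt.le
    simp only at this
    omega
  simp only at hab hnE
  unfold EmptyArc at hnE
  push Not at hnE
  obtain ⟨k, l, hkl, h1, h2, h3⟩ := hnE
  have ha := ord_self n a
  have hkl' := ord_rebase n a k l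
  have hlt := ord_lt n a
  by_cases hk : k = a
  · subst hk
    have hlb : l ≠ b := fun h => h3 (by rw [h])
    have h4 := ord_ne n k hlb
    have hE : EmptyArc n P k l := hshort _ _ hkl (by omega)
    refine ⟨l, k, Or.inr ⟨hkl, hE, fun x hx => ?_⟩⟩
    have hx' : s(l, x) ∈ P := by rwa [Sym2.eq_swap]
    have h5 := hadm.ord_le_of_mem hab hx' (by omega) (by omega)
    have h6 := ord_ne n k (hadm.ne_of_mem hx)
    rcases Nat.lt_or_ge (ord n k x) (ord n k l) with h7 | h7
    · left
      exact Sym2.congr_left.1 (hE x l hx h7 le_rfl)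
    · right
      have := ord_rebase n k l x
      exact hshort _ _ hx' (by omega)
  · have h4 := ord_ne n a hk
    have hE : EmptyArc n P k l := hshort _ _ hkl (by omega)
    refine ⟨k, l, Or.inl ⟨hkl, hE, fun x hx => ?_⟩⟩
    have hx' : s(x, k) ∈ P := by rwa [Sym2.eq_swap]
    have h5 := hadm.ord_le_of_mem hab hx (by omega) (by omega)
    have h6 := ord_ne n a (hadm.ne_of_mem hx)
    rcases Nat.lt_or_ge (ord n a x) (ord n a k) with h7 | h7
    · right
      have := ord_rebase n a x k
      exact hshort _ _ hx' (by omega)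
    · left
      have := ord_rebase n a k x
      exact (hshort _ _ hx (by omega)).right_unique n hE hx hkl (hadm.ne_of_mem hx)
        (hadm.ne_of_mem hkl)

/-- normal form up to dihedral transformation.
Let `W` be an admissible Wilson loop diagram with `k ≥ 1` propagators.  Then
there is a dihedral transformation `W'` of `W` containing a propagator
`p = (i, n-1)` for some `i` such that no propagator lies inside `(p, <_i)`,
and such that either the edge `i` of `W'` supports no propagator other than
`p`, or the edge `i` of `W'` supports exactly one other propagator `q = (j, i)`,
which has no propagator inside `(q, <_j)`.  (Recall that the vertex `n-1` is
`-1` in `ZMod n`.) -/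
theorem exists_dihedral_with_good_propagator
    (n : ℕ) [NeZero n] (P : Finset (Prp n))
    (hadm : IsAdmissible n P) (hne : P.Nonempty) :
    ∃ g : ZMod n → ZMod n,
      ((∃ c : ZMod n, g = fun e => e + c) ∨ (∃ c : ZMod n, g = fun e => c - 1 - e)) ∧
      ∃ i : ZMod n,
        (s(i, -1) : Prp n) ∈ P.image (Sym2.map g) ∧
        (∀ r ∈ P.image (Sym2.map g),
          InsideDir n i (s(i, -1) : Prp n) r → r = (s(i, -1) : Prp n)) ∧
        ((∀ r ∈ P.image (Sym2.map g), i ∈ r → r = (s(i, -1) : Prp n)) ∨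
         (∃ j : ZMod n, (s(j, i) : Prp n) ∈ P.image (Sym2.map g) ∧
            (s(j, i) : Prp n) ≠ (s(i, -1) : Prp n) ∧
            (∀ r ∈ P.image (Sym2.map g), i ∈ r →
              r = (s(i, -1) : Prp n) ∨ r = (s(j, i) : Prp n)) ∧
            (∀ r ∈ P.image (Sym2.map g),
              InsideDir n j (s(j, i) : Prp n) r → r = (s(j, i) : Prp n)))) := by
  obtain ⟨i, m, h | h⟩ := hadm.exists_good n hne
  · obtain ⟨c, hc⟩ := h.exists_rotation n fun _ _ => hadm.ne_of_mem
    exact ⟨fun e => e + c, Or.inl ⟨c, rfl⟩, hc⟩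
  · obtain ⟨c, hc⟩ := (h.image_neg n).exists_rotation n fun x y hxy => by
      have hmem := (mem_image_map_equiv n (Equiv.neg _) P x y).1 hxy
      simpa using hadm.ne_of_mem hmem
    rw [Finset.image_image, ← Sym2.map_comp] at hc
    refine ⟨_, Or.inr ⟨c + 1, ?_⟩, hc⟩
    funext e
    simp only [Function.comp_apply]
    ring

end WLD
end
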